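/- Let G be a group and A an abelian normal subgroup of G such that G/A is a finitely generated nilpotent group. If G is not locally nilpotent, then G contains a proper contranormal subgroup. -/

import Mathlib

open scoped commutatorElement

/-- Subgroups obtained from the trivial one by successively adjoining elements that are central
modulo the subgroup constructed so far. -/
inductive CentralChain {Q : Type*} [Group Q] : Subgroup Q → Prop
  | bot : CentralChain ⊥
  | step (H : Subgroup Q) (x : Q) : CentralChain H → (∀ q, ⁅x, q⁆ ∈ H) →
      CentralChain (H ⊔ Subgroup.zpowers x)

section Chain

variable {Q : Type*} [Group Q]

theorem Subgroup.normal_of_commutator_mem {H : Subgroup Q} (h : ∀ x ∈ H, ∀ q, ⁅x, q⁆ ∈ H) :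
    H.Normal := by
  refine ⟨fun x hx q => ?_⟩
  have h1 : q * x * q⁻¹ = ⁅x, q⁆⁻¹ * x := by
    simp [commutatorElement_def, mul_assoc]
  rw [h1]
  exact H.mul_mem (H.inv_mem (h x hx q)) hx

/-- The elements that commute with `x` modulo a normal subgroup. -/
def centralizerMod (N : Subgroup Q) [hN : N.Normal] (x : Q) : Subgroup Q :=
  (Subgroup.centralizer {(QuotientGroup.mk' N x)}).comap (QuotientGroup.mk' N)

theorem mem_centralizerMod {N : Subgroup Q} [N.Normal] {x q : Q} :
    q ∈ centralizerMod N x ↔ ⁅x, q⁆ ∈ N := by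
  rw [centralizerMod, Subgroup.mem_comap, Subgroup.mem_centralizer_singleton_iff,
    ← QuotientGroup.eq_one_iff, ← QuotientGroup.mk'_apply, map_commutatorElement,
    commutatorElement_eq_one_iff_mul_comm, eq_comm]

theorem mem_centralizerMod_comm {N : Subgroup Q} [N.Normal] {x q : Q} :
    q ∈ centralizerMod N x ↔ x ∈ centralizerMod N q := by
  rw [mem_centralizerMod, mem_centralizerMod, ← inv_mem_iff, commutatorElement_inv]

theorem normal_sup_zpowers {H : Subgroup Q} [hH : H.Normal] {x : Q} (hx : ∀ q, ⁅x, q⁆ ∈ H) :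
    (H ⊔ Subgroup.zpowers x).Normal := by
  refine Subgroup.normal_of_commutator_mem fun y hy q => ?_
  apply (le_sup_left : H ≤ _)
  rw [← mem_centralizerMod, mem_centralizerMod_comm]
  refine (sup_le (fun h hh => ?_) ?_ : H ⊔ Subgroup.zpowers x ≤ _) hy
  · rw [mem_centralizerMod, commutatorElement_def, mul_assoc, mul_assoc, ← mul_assoc h]
    have := hH.conj_mem _ (H.mul_mem (hH.conj_mem _ hh q) (H.inv_mem hh)) 1
    simpa [mul_assoc] using this
  · rw [Subgroup.zpowers_le, mem_centralizerMod_comm, mem_centralizerMod]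
    exact hx q

theorem CentralChain.normal {H : Subgroup Q} (h : CentralChain H) : H.Normal := by
  induction h with
  | bot => infer_instance
  | step H x _ hx ih => exact normal_sup_zpowers hx

theorem CentralChain.fg {H : Subgroup Q} (h : CentralChain H) : H.FG := by
  induction h with
  | bot => exact ⟨∅, by simp⟩
  | step H x _ hx ih =>
    exact ih.sup ⟨{x}, by simp [Subgroup.zpowers_eq_closure]⟩

theorem CentralChain.sup_closure {H : Subgroup Q} (h : CentralChain H) (S : Finset Q)
    (hS : ∀ s ∈ S, ∀ q, ⁅s, q⁆ ∈ H) : CentralChain (H ⊔ Subgroup.closure (S : Set Q)) := by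
  classical
  induction S using Finset.induction_on with
  | empty => simpa using h
  | insert a S _ ih =>
    have := CentralChain.step _ a (ih fun s hs => hS s (Finset.mem_insert_of_mem hs))
      fun q => (le_sup_left : H ≤ _) (hS a (Finset.mem_insert_self a S) q)
    rwa [sup_assoc, Subgroup.zpowers_eq_closure, ← Subgroup.closure_union, Set.union_comm,
      ← Set.insert_eq, ← Finset.coe_insert] at this

theorem exists_finset_lowerCentralSeries (hfg : Group.FG Q) (j : ℕ) :
    ∃ S : Finset Q, (∀ s ∈ S, s ∈ Subgroup.lowerCentralSeries (⊤ : Subgroup Q) j) ∧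
      Subgroup.lowerCentralSeries (⊤ : Subgroup Q) j =
        Subgroup.lowerCentralSeries (⊤ : Subgroup Q) (j + 1) ⊔ Subgroup.closure (S : Set Q) := by
  classical
  obtain ⟨X, hX⟩ := hfg.out
  induction j with
  | zero => exact ⟨X, by simp, by simp [hX]⟩
  | succ j ih =>
    obtain ⟨S, hS, hSj⟩ := ih
    set Y : Finset Q := (S ×ˢ X).image fun p => ⁅p.1, p.2⁆ with hY
    have hcomm : ∀ i, ∀ y ∈ Subgroup.lowerCentralSeries (⊤ : Subgroup Q) i, ∀ q : Q,
        ⁅y, q⁆ ∈ Subgroup.lowerCentralSeries (⊤ : Subgroup Q) (i + 1) := fun i y hy q =>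
      Subgroup.commutator_mem_commutator hy (Subgroup.mem_top q)
    have hYmem : ∀ y ∈ Y, y ∈ Subgroup.lowerCentralSeries (⊤ : Subgroup Q) (j + 1) := by
      intro y hy
      obtain ⟨p, hp, rfl⟩ := Finset.mem_image.1 hy
      exact hcomm j _ (hS _ (Finset.mem_product.1 hp).1) _
    refine ⟨Y, hYmem, le_antisymm ?_ (sup_le
      ((Subgroup.lowerCentralSeries_antitone (S := ⊤)) (Nat.le_succ _))
      ((Subgroup.closure_le _).2 hYmem))⟩
    set K := Subgroup.lowerCentralSeries (⊤ : Subgroup Q) (j + 1 + 1) ⊔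
      Subgroup.closure (Y : Set Q) with hK
    have hKle : K ≤ Subgroup.lowerCentralSeries (⊤ : Subgroup Q) (j + 1) :=
      sup_le ((Subgroup.lowerCentralSeries_antitone (S := ⊤)) (Nat.le_succ _))
        ((Subgroup.closure_le _).2 hYmem)
    have hKn : K.Normal := Subgroup.normal_of_commutator_mem fun x hx q =>
      (le_sup_left : _ ≤ K) (hcomm _ _ (hKle hx) q)
    have key : ∀ q, Subgroup.lowerCentralSeries (⊤ : Subgroup Q) j ≤ centralizerMod K q := by
      intro q
      rw [hSj]
      refine sup_le (fun y hy => ?_) ((Subgroup.closure_le _).2 fun s hs => ?_)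
      · rw [mem_centralizerMod_comm, mem_centralizerMod]
        exact (le_sup_left : _ ≤ K) (hcomm _ _ hy q)
      · have : Subgroup.closure (X : Set Q) ≤ centralizerMod K s :=
          (Subgroup.closure_le _).2 fun x hx => mem_centralizerMod.2
            ((le_sup_right : _ ≤ K) (Subgroup.subset_closure
              (Finset.mem_image.2 ⟨(s, x), Finset.mem_product.2 ⟨hs, hx⟩, rfl⟩)))
        rw [hX] at this
        exact mem_centralizerMod_comm.1 (this (Subgroup.mem_top q))
    refine Subgroup.commutator_le.2 fun y hy q _ => ?_
    exact mem_centralizerMod.1 (mem_centralizerMod_comm.1 (key q hy))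

theorem CentralChain.top (hfg : Group.FG Q) (hnil : Group.IsNilpotent Q) :
    CentralChain (⊤ : Subgroup Q) := by
  obtain ⟨n, hn⟩ := Subgroup.nilpotent_iff_lowerCentralSeries.1 hnil
  suffices h : ∀ i ≤ n, CentralChain (Subgroup.lowerCentralSeries (⊤ : Subgroup Q) (n - i)) by
    simpa using h n le_rfl
  intro i
  induction i with
  | zero => intro _; rw [Nat.sub_zero, hn]; exact CentralChain.bot
  | succ i ih =>
    intro hi
    obtain ⟨S, hS, hSj⟩ := exists_finset_lowerCentralSeries hfg (n - (i + 1))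
    have e : n - (i + 1) + 1 = n - i := by omega
    rw [hSj, e]
    refine (ih (by omega)).sup_closure S fun s hs q => ?_
    rw [← e]
    exact Subgroup.commutator_mem_commutator (hS s hs) (Subgroup.mem_top q)

end Chain

section Generic

variable {J V : Type*} [CommRing J] [AddCommGroup V] [Module J V]

/-- In `U / L`, multiplication by `f` is injective and every `f`-divisible submodule is
`g`-power torsion. -/
structure DivisibleTorsion (f g : J) (L U : Submodule J V) : Prop where
  inj : ∀ u ∈ U, f • u ∈ L → u ∈ L
  torsion : ∀ D : Submodule J V, L ≤ D → D ≤ U → (∀ d ∈ D, ∃ e ∈ D, d - f • e ∈ L) →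
    ∀ d ∈ D, ∃ k : ℕ, g ^ k • d ∈ L

theorem DivisibleTorsion.of_dvd {f g g' : J} {L U : Submodule J V} (h : DivisibleTorsion f g L U)
    (hg : g ∣ g') : DivisibleTorsion f g' L U := by
  refine ⟨h.inj, fun D h1 h2 h3 d hd => ?_⟩
  obtain ⟨k, hk⟩ := h.torsion D h1 h2 h3 d hd
  obtain ⟨c, rfl⟩ := hg
  refine ⟨k, ?_⟩
  rw [mul_pow, mul_comm, mul_smul]
  exact L.smul_mem _ hk

theorem DivisibleTorsion.refl (f g : J) (L : Submodule J V) : DivisibleTorsion f g L L :=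
  ⟨fun _ hu _ => hu, fun _ _ h2 _ d hd => ⟨0, by simpa using h2 hd⟩⟩

theorem DivisibleTorsion.trans {f g : J} {L M U : Submodule J V} (hLM : L ≤ M) (hMU : M ≤ U)
    (h1 : DivisibleTorsion f g L M) (h2 : DivisibleTorsion f g M U) :
    DivisibleTorsion f g L U := by
  refine ⟨fun u hu hf => h1.inj u (h2.inj u hu (hLM hf)) hf, fun D hLD hDU hD d hd => ?_⟩
  obtain ⟨k, hk⟩ : ∃ k : ℕ, g ^ k • d ∈ M := by
    refine h2.torsion (D ⊔ M) le_sup_right (sup_le hDU hMU) (fun y hy => ?_) d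
      (Submodule.mem_sup_left hd)
    obtain ⟨a, ha, m, hm, rfl⟩ := Submodule.mem_sup.1 hy
    obtain ⟨e, he, hae⟩ := hD a ha
    refine ⟨e, Submodule.mem_sup_left he, ?_⟩
    rw [add_sub_right_comm]
    exact M.add_mem (hLM hae) hm
  obtain ⟨l, hl⟩ : ∃ l : ℕ, g ^ l • g ^ k • d ∈ L := by
    refine h1.torsion (D ⊓ M) (le_inf hLD hLM) inf_le_right (fun y hy => ?_) _
      ⟨D.smul_mem _ hd, hk⟩
    obtain ⟨e, he, hye⟩ := hD y hy.1
    refine ⟨e, ⟨he, h2.inj e (hDU he) ?_⟩, hye⟩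
    have := M.sub_mem hy.2 (hLM hye)
    rwa [sub_sub_cancel] at this
  exact ⟨l + k, by rwa [pow_add, mul_smul]⟩

theorem DivisibleTorsion.of_chain {f g : J} (M : ℕ → Submodule J V) (hM : Monotone M)
    (h : ∀ n, DivisibleTorsion f g (M n) (M (n + 1))) (i j : ℕ) (hij : i ≤ j) :
    DivisibleTorsion f g (M i) (M j) := by
  induction j, hij using Nat.le_induction with
  | base => exact .refl f g _
  | succ j hij ih => exact .trans (hM hij) (hM (Nat.le_succ j)) ih (h j)

theorem DivisibleTorsion.iSup {f g : J} (M : ℕ → Submodule J V) (hM : Monotone M)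
    (h : ∀ n, DivisibleTorsion f g (M n) (M (n + 1))) :
    DivisibleTorsion f g (M 0) (⨆ n, M n) := by
  have hmem : ∀ u ∈ ⨆ n, M n, ∃ n, u ∈ M n := fun u hu =>
    (Submodule.mem_iSup_of_directed M hM.directed_le).1 hu
  have hchain := DivisibleTorsion.of_chain M hM h
  refine ⟨fun u hu hf => ?_, fun D hLD hDU hD d hd => ?_⟩
  · obtain ⟨n, hn⟩ := hmem u hu
    exact (hchain 0 n n.zero_le).inj u hn hf
  · obtain ⟨n, hn⟩ := hmem d (hDU hd)
    refine (hchain 0 n n.zero_le).torsion (D ⊓ M n) (le_inf hLD (hM n.zero_le)) inf_le_right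
      (fun y hy => ?_) d ⟨hd, hn⟩
    obtain ⟨e, he, hye⟩ := hD y hy.1
    obtain ⟨m, hm⟩ := hmem e (hDU he)
    refine ⟨e, ⟨he, ?_⟩, hye⟩
    refine (hchain n (max n m) (le_max_left n m)).inj e (hM (le_max_right n m) hm) ?_
    have := (M n).sub_mem hy.2 (hM n.zero_le hye)
    rwa [sub_sub_cancel] at this

/-- The generic form of `DivisibleTorsion`: it holds for all nonzero nonunits `f` congruent
to `1` modulo some fixed nonzero `g`. -/
def GenericallyReduced (L U : Submodule J V) : Prop :=
  ∃ g : J, g ≠ 0 ∧ ∀ f : J, f ≠ 0 → ¬ IsUnit f → g ∣ f - 1 → DivisibleTorsion f g L U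

/-- `U` belongs to the sublattice `I`, satisfies the ascending chain condition on members of `I`,
and all its quotients by members of `I` are generically reduced. -/
structure GenericallyGood (I : Sublattice (Submodule J V)) (U : Submodule J V) : Prop where
  mem : U ∈ I
  acc : ∀ W : ℕ →o Submodule J V, (∀ n, W n ∈ I) → (∀ n, W n ≤ U) → ∃ n, ∀ m ≥ n, W m = W n
  reduced : ∀ L ∈ I, L ≤ U → GenericallyReduced L U

/-- The members of `I` mapped into themselves by `x`. -/
def stableSublattice (I : Sublattice (Submodule J V)) (x : V ≃ₗ[J] V) :
    Sublattice (Submodule J V) where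
  carrier := {U | U ∈ I ∧ ∀ u ∈ U, x u ∈ U}
  supClosed' := by
    rintro U ⟨hU, hxU⟩ W ⟨hW, hxW⟩
    refine ⟨I.sup_mem hU hW, fun u hu => ?_⟩
    obtain ⟨a, ha, b, hb, rfl⟩ := Submodule.mem_sup.1 hu
    rw [map_add]
    exact Submodule.add_mem_sup (hxU a ha) (hxW b hb)
  infClosed' := by
    rintro U ⟨hU, hxU⟩ W ⟨hW, hxW⟩
    exact ⟨I.inf_mem hU hW, fun u hu => ⟨hxU u hu.1, hxW u hu.2⟩⟩

theorem mem_stableSublattice {I : Sublattice (Submodule J V)} {x : V ≃ₗ[J] V}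
    {U : Submodule J V} : U ∈ stableSublattice I x ↔ U ∈ I ∧ ∀ u ∈ U, x u ∈ U := Iff.rfl

/-- `L + U₀ + x U₀ + ⋯ + xⁿ⁻¹ U₀`. -/
def orbitFiltration (x : V ≃ₗ[J] V) (U₀ L : Submodule J V) : ℕ → Submodule J V
  | 0 => L
  | n + 1 => orbitFiltration x U₀ L n ⊔ U₀.map (x ^ n : V ≃ₗ[J] V).toLinearMap

/-- The module of leading coefficients of degree `n` of `L`. -/
def leadingCoeffs (x : V ≃ₗ[J] V) (U₀ L : Submodule J V) (n : ℕ) : Submodule J V :=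
  U₀ ⊓ (orbitFiltration x U₀ L n).comap (x ^ n : V ≃ₗ[J] V).toLinearMap

/-- `U₀ + x U₀ + x² U₀ + ⋯`. -/
def orbitSpan (x : V ≃ₗ[J] V) (U₀ : Submodule J V) : Submodule J V :=
  ⨆ n : ℕ, U₀.map (x ^ n : V ≃ₗ[J] V).toLinearMap

section Step

variable {x : V ≃ₗ[J] V} {U₀ L L' : Submodule J V}

theorem orbitFiltration_monotone : Monotone (orbitFiltration x U₀ L) :=
  monotone_nat_of_le_succ fun _ => le_sup_left

theorem orbitFiltration_mono (h : L ≤ L') (n : ℕ) :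
    orbitFiltration x U₀ L n ≤ orbitFiltration x U₀ L' n := by
  induction n with
  | zero => exact h
  | succ n ih => exact sup_le_sup_right ih _

theorem apply_mem_orbitFiltration (hL : ∀ u ∈ L, x u ∈ L) (n : ℕ) :
    ∀ u ∈ orbitFiltration x U₀ L n, x u ∈ orbitFiltration x U₀ L (n + 1) := by
  induction n with
  | zero => exact fun u hu => Submodule.mem_sup_left (hL u hu)
  | succ n ih =>
    intro u hu
    obtain ⟨a, ha, b, ⟨c, hc, rfl⟩, rfl⟩ := Submodule.mem_sup.1 hu
    rw [map_add]
    refine Submodule.add_mem_sup (ih a ha) ⟨c, hc, ?_⟩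
    simp [pow_succ']

theorem leadingCoeffs_monotone (hL : ∀ u ∈ L, x u ∈ L) : Monotone (leadingCoeffs x U₀ L) :=
  monotone_nat_of_le_succ fun n v hv => ⟨hv.1, by
    have := apply_mem_orbitFiltration hL n _ hv.2
    simpa [pow_succ'] using this⟩

theorem leadingCoeffs_mono (h : L ≤ L') (n : ℕ) :
    leadingCoeffs x U₀ L n ≤ leadingCoeffs x U₀ L' n :=
  inf_le_inf_left _ (Submodule.comap_mono (orbitFiltration_mono h n))

theorem iSup_orbitFiltration (h : L ≤ orbitSpan x U₀) :
    ⨆ n, orbitFiltration x U₀ L n = orbitSpan x U₀ := by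
  apply le_antisymm
  · refine iSup_le fun n => ?_
    induction n with
    | zero => exact h
    | succ n ih =>
      exact sup_le ih (le_iSup (fun n : ℕ => U₀.map (x ^ n : V ≃ₗ[J] V).toLinearMap) n)
  · exact iSup_le fun n => le_trans le_sup_right (le_iSup (orbitFiltration x U₀ L) (n + 1))

theorem le_of_leadingCoeffs_le (hLL : L ≤ L') (hL' : L' ≤ orbitSpan x U₀)
    (h : ∀ n, leadingCoeffs x U₀ L' n ≤ leadingCoeffs x U₀ L n) : L' ≤ L := by
  have key : ∀ n, L' ⊓ orbitFiltration x U₀ L n ≤ L := by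
    intro n
    induction n with
    | zero => exact inf_le_right
    | succ n ih =>
      rintro w ⟨hw, hwn⟩
      obtain ⟨m, hm, _, ⟨v, hv, rfl⟩, rfl⟩ := Submodule.mem_sup.1 hwn
      refine ih ⟨hw, Submodule.add_mem _ hm (h n ⟨hv, ?_⟩).2⟩
      have h1 := Submodule.sub_mem _ (orbitFiltration_monotone (Nat.zero_le n) hw)
        (orbitFiltration_mono hLL n hm)
      rwa [add_sub_cancel_left] at h1
  intro w hw
  have hw' := hL' hw
  rw [← iSup_orbitFiltration (hLL.trans hL'),
    Submodule.mem_iSup_of_directed _ orbitFiltration_monotone.directed_le] at hw'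
  obtain ⟨n, hn⟩ := hw'
  exact key n ⟨hw, hn⟩

theorem DivisibleTorsion.orbitFiltration_succ {f g : J} {n : ℕ}
    (h : DivisibleTorsion f g (leadingCoeffs x U₀ L n) U₀) :
    DivisibleTorsion f g (orbitFiltration x U₀ L n) (orbitFiltration x U₀ L (n + 1)) := by
  set M := orbitFiltration x U₀ L n with hM
  set y := (x ^ n : V ≃ₗ[J] V).toLinearMap with hy
  have hsucc : ∀ u, u ∈ orbitFiltration x U₀ L (n + 1) ↔ ∃ m ∈ M, ∃ v ∈ U₀, m + y v = u := by
    intro u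
    refine Submodule.mem_sup.trans ⟨?_, ?_⟩
    · rintro ⟨m, hm, _, ⟨v, hv, rfl⟩, rfl⟩
      exact ⟨m, hm, v, hv, rfl⟩
    · rintro ⟨m, hm, v, hv, rfl⟩
      exact ⟨m, hm, _, ⟨v, hv, rfl⟩, rfl⟩
  have hlead : ∀ v, v ∈ leadingCoeffs x U₀ L n ↔ v ∈ U₀ ∧ y v ∈ M := fun v => Iff.rfl
  refine ⟨fun u hu hf => ?_, fun D hMD hDU hD d hd => ?_⟩
  · obtain ⟨m, hm, v, hv, rfl⟩ := (hsucc u).1 hu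
    rw [smul_add, Submodule.add_mem_iff_right _ (M.smul_mem f hm), ← map_smul] at hf
    exact M.add_mem hm (h.inj v hv ⟨U₀.smul_mem f hv, hf⟩).2
  · obtain ⟨m, hm, v, hv, rfl⟩ := (hsucc d).1 (hDU hd)
    have hvD : y v ∈ D := (D.add_mem_iff_right (hMD hm)).1 hd
    obtain ⟨k, hk⟩ : ∃ k : ℕ, g ^ k • v ∈ leadingCoeffs x U₀ L n := by
      refine h.torsion (U₀ ⊓ D.comap y) (inf_le_inf_left _ (Submodule.comap_mono hMD))
        inf_le_left (fun w hw => ?_) v ⟨hv, hvD⟩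
      obtain ⟨e, he, hwe⟩ := hD _ hw.2
      obtain ⟨m', hm', w', hw', rfl⟩ := (hsucc e).1 (hDU he)
      refine ⟨w', ⟨hw', (D.add_mem_iff_right (hMD hm')).1 he⟩,
        U₀.sub_mem hw.1 (U₀.smul_mem f hw'), ?_⟩
      have := M.add_mem hwe (M.smul_mem f hm')
      rw [smul_add, sub_add_eq_sub_sub, sub_right_comm, sub_add_cancel, ← map_smul,
        ← map_sub] at this
      exact this
    refine ⟨k, ?_⟩
    rw [smul_add, ← map_smul]
    exact M.add_mem (M.smul_mem _ hm) hk.2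

variable {I : Sublattice (Submodule J V)}

theorem map_pow_mem (hx : ∀ U ∈ I, U.map x.toLinearMap ∈ I) (hU : U₀ ∈ I) (n : ℕ) :
    U₀.map (x ^ n : V ≃ₗ[J] V).toLinearMap ∈ I := by
  induction n with
  | zero =>
    have : ((x ^ 0 : V ≃ₗ[J] V)).toLinearMap = LinearMap.id := rfl
    rwa [this, Submodule.map_id]
  | succ n ih =>
    have h := hx _ ih
    rw [← Submodule.map_comp] at h
    rwa [pow_succ']

theorem comap_pow_mem (hx : ∀ U ∈ I, U.comap x.toLinearMap ∈ I) (hU : U₀ ∈ I) (n : ℕ) :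
    U₀.comap (x ^ n : V ≃ₗ[J] V).toLinearMap ∈ I := by
  induction n with
  | zero =>
    have : ((x ^ 0 : V ≃ₗ[J] V)).toLinearMap = LinearMap.id := rfl
    rwa [this, Submodule.comap_id]
  | succ n ih =>
    have h := hx _ ih
    rw [← Submodule.comap_comp] at h
    rwa [pow_succ]

theorem leadingCoeffs_mem (hx : ∀ U ∈ I, U.map x.toLinearMap ∈ I)
    (hx' : ∀ U ∈ I, U.comap x.toLinearMap ∈ I) (hU : U₀ ∈ I) (hL : L ∈ I) (n : ℕ) :
    leadingCoeffs x U₀ L n ∈ I := by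
  refine I.inf_mem hU (comap_pow_mem hx' ?_ n)
  induction n with
  | zero => exact hL
  | succ n ih => exact I.sup_mem ih (map_pow_mem hx hU n)

theorem GenericallyGood.orbitSpan [IsDomain J] (hx : ∀ U ∈ I, U.map x.toLinearMap ∈ I)
    (hx' : ∀ U ∈ I, U.comap x.toLinearMap ∈ I) (h : GenericallyGood I U₀)
    (hmem : orbitSpan x U₀ ∈ I) :
    GenericallyGood (stableSublattice I x) (orbitSpan x U₀) := by
  have hlead : ∀ L ∈ I, ∀ n, leadingCoeffs x U₀ L n ∈ I := fun L hL n =>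
    leadingCoeffs_mem hx hx' h.mem hL n
  refine ⟨⟨hmem, fun u hu => ?_⟩, fun W hW hWU => ?_, fun L hL hLU => ?_⟩
  · refine (iSup_le fun n => ?_ : _root_.orbitSpan x U₀ ≤
      (_root_.orbitSpan x U₀).comap x.toLinearMap) hu
    rw [Submodule.map_le_iff_le_comap, ← Submodule.comap_comp]
    intro v hv
    refine (le_iSup (fun n : ℕ => U₀.map (x ^ n : V ≃ₗ[J] V).toLinearMap) (n + 1)) ⟨v, hv, ?_⟩
    rw [pow_succ']
    rfl
  · have hWI : ∀ n, W n ∈ I := fun n => (hW n).1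
    have hmono : ∀ {n n' k k'}, n ≤ n' → k ≤ k' →
        leadingCoeffs x U₀ (W k) n ≤ leadingCoeffs x U₀ (W k') n' := fun hn hk =>
      (leadingCoeffs_monotone (hW _).2 hn).trans (leadingCoeffs_mono (W.monotone hk) _)
    obtain ⟨N, hN⟩ := h.acc ⟨fun k => leadingCoeffs x U₀ (W k) k, fun _ _ h => hmono h h⟩
      (fun n => hlead _ (hWI n) n) (fun _ => inf_le_left)
    choose K hK using fun n => h.acc ⟨fun k => leadingCoeffs x U₀ (W k) n,
      fun _ _ h => hmono le_rfl h⟩ (fun k => hlead _ (hWI k) n) (fun _ => inf_le_left)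
    refine ⟨max N ((Finset.range N).sup K), fun m hm => le_antisymm
      (le_of_leadingCoeffs_le (W.monotone hm) (hWU m) fun n => ?_) (W.monotone hm)⟩
    rcases lt_or_ge n N with hn | hn
    · have h1 : K n ≤ max N ((Finset.range N).sup K) :=
        (Finset.le_sup (Finset.mem_range.2 hn)).trans (le_max_right _ _)
      exact ((hK n m (h1.trans hm)).trans (hK n _ h1).symm).le
    · calc leadingCoeffs x U₀ (W m) n ≤ leadingCoeffs x U₀ (W (max m n)) (max m n) :=
            hmono (le_max_right _ _) (le_max_left _ _)
        _ = leadingCoeffs x U₀ (W N) N := hN _ (hn.trans (le_max_right _ _))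
        _ ≤ _ := hmono hn (le_max_left _ _)
  · obtain ⟨N, hN⟩ := h.acc ⟨leadingCoeffs x U₀ L, leadingCoeffs_monotone hL.2⟩
      (fun n => hlead _ hL.1 n) (fun _ => inf_le_left)
    choose g hg0 hg using fun n => h.reduced _ (hlead L hL.1 n) inf_le_left
    refine ⟨∏ i ∈ Finset.range (N + 1), g i, Finset.prod_ne_zero_iff.2 fun i _ => hg0 i,
      fun f hf0 hfu hf => ?_⟩
    have hdvd : ∀ i ≤ N, g i ∣ ∏ i ∈ Finset.range (N + 1), g i := fun i hi =>
      Finset.dvd_prod_of_mem g (Finset.mem_range.2 (Nat.lt_succ_of_le hi))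
    rw [← iSup_orbitFiltration hLU]
    refine DivisibleTorsion.iSup _ orbitFiltration_monotone fun n =>
      DivisibleTorsion.orbitFiltration_succ ?_
    rcases le_total n N with hn | hn
    · exact (hg n f hf0 hfu ((hdvd n hn).trans hf)).of_dvd (hdvd n hn)
    · rw [show leadingCoeffs x U₀ L n = leadingCoeffs x U₀ L N from hN n hn]
      exact (hg N f hf0 hfu ((hdvd N le_rfl).trans hf)).of_dvd (hdvd N le_rfl)

end Step

theorem genericallyReduced_sup_span_singleton [IsDomain J] [IsNoetherianRing J]
    (L : Submodule J V) (v : V) : GenericallyReduced L (L ⊔ Submodule.span J {v}) := by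
  have hmem : ∀ u ∈ L ⊔ Submodule.span J {v}, ∃ m ∈ L, ∃ j : J, m + j • v = u := by
    intro u hu
    obtain ⟨m, hm, b, hb, rfl⟩ := Submodule.mem_sup.1 hu
    obtain ⟨j, rfl⟩ := Submodule.mem_span_singleton.1 hb
    exact ⟨m, hm, j, rfl⟩
  by_cases hℓ : ∃ g : J, g ≠ 0 ∧ g • v ∈ L
  · obtain ⟨g, hg0, hg⟩ := hℓ
    have hgU : ∀ u ∈ L ⊔ Submodule.span J {v}, g • u ∈ L := by
      intro u hu
      obtain ⟨m, hm, j, rfl⟩ := hmem u hu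
      rw [smul_add, smul_comm]
      exact L.add_mem (L.smul_mem _ hm) (L.smul_mem _ hg)
    refine ⟨g, hg0, fun f _ _ hf => ⟨fun u hu hfu => ?_, fun D _ hDU _ d hd =>
      ⟨1, by simpa using hgU d (hDU hd)⟩⟩⟩
    obtain ⟨c, hc⟩ := hf
    have : u = f • u - c • g • u := by
      rw [smul_smul, mul_comm c, ← hc, ← sub_smul, sub_sub_cancel, one_smul]
    rw [this]
    exact L.sub_mem hfu (L.smul_mem _ (hgU u hu))
  · push Not at hℓ
    have hzero : ∀ j : J, j • v ∈ L → j = 0 := fun j hj => by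
      by_contra h
      exact hℓ j h hj
    refine ⟨1, one_ne_zero, fun f hf0 hfu _ => ⟨fun u hu hfL => ?_, fun D hLD hDU hD d hd => ?_⟩⟩
    · obtain ⟨m, hm, j, rfl⟩ := hmem u hu
      rw [smul_add, L.add_mem_iff_right (L.smul_mem _ hm), smul_smul] at hfL
      rw [(mul_eq_zero.1 (hzero _ hfL)).resolve_left hf0, zero_smul, add_zero]
      exact hm
    · set D₀ : Ideal J := D.comap (LinearMap.toSpanSingleton J V v) with hD₀
      have hle : D₀ ≤ Ideal.span {f} • D₀ := by
        intro j hj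
        obtain ⟨e, he, hje⟩ := hD _ (show j • v ∈ D from hj)
        obtain ⟨m, hm, i, rfl⟩ := hmem e (hDU he)
        have hi : i ∈ D₀ := (D.add_mem_iff_right (hLD hm)).1 he
        have : (j - f * i) • v ∈ L := by
          have := L.add_mem hje (L.smul_mem f hm)
          rwa [smul_add, sub_add_eq_sub_sub, sub_right_comm, sub_add_cancel, smul_smul,
            ← sub_smul] at this
        rw [sub_eq_zero.1 (hzero _ this)]
        exact Submodule.smul_mem_smul (Ideal.mem_span_singleton_self f) hi
      obtain ⟨r, hr, hrD⟩ := Submodule.exists_sub_one_mem_and_smul_eq_zero_of_fg_of_le_smul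
        (Ideal.span {f}) D₀ (IsNoetherian.noetherian D₀) hle
      have hr0 : r ≠ 0 := by
        rintro rfl
        rw [zero_sub, neg_mem_iff, Ideal.mem_span_singleton] at hr
        exact hfu (isUnit_of_dvd_one hr)
      obtain ⟨m, hm, j, rfl⟩ := hmem d (hDU hd)
      have hj : j = 0 := (mul_eq_zero.1 (hrD j ((D.add_mem_iff_right (hLD hm)).1 hd))).resolve_left
        hr0
      exact ⟨0, by simpa [hj] using hm⟩

theorem GenericallyReduced.trans [IsDomain J] {L M U : Submodule J V} (hLM : L ≤ M)
    (hMU : M ≤ U) (h1 : GenericallyReduced L M) (h2 : GenericallyReduced M U) :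
    GenericallyReduced L U := by
  obtain ⟨g, hg0, hg⟩ := h1
  obtain ⟨g', hg0', hg'⟩ := h2
  refine ⟨g * g', mul_ne_zero hg0 hg0', fun f hf0 hfu hf => ?_⟩
  exact ((hg f hf0 hfu ((dvd_mul_right g g').trans hf)).of_dvd (dvd_mul_right g g')).trans hLM hMU
    ((hg' f hf0 hfu ((dvd_mul_left g' g).trans hf)).of_dvd (dvd_mul_left g' g))

theorem genericallyReduced_sup_span [IsDomain J] [IsNoetherianRing J]
    (L : Submodule J V) (X : Finset V) :
    GenericallyReduced L (L ⊔ Submodule.span J (X : Set V)) := by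
  classical
  induction X using Finset.induction_on with
  | empty => simpa using ⟨1, one_ne_zero, fun f _ _ _ => DivisibleTorsion.refl f 1 L⟩
  | insert a X _ ih =>
    rw [Finset.coe_insert, Submodule.span_insert, sup_comm (Submodule.span J {a}), ← sup_assoc]
    exact ih.trans le_sup_left le_sup_left (genericallyReduced_sup_span_singleton _ a)

theorem genericallyGood_top_span [IsDomain J] [IsNoetherianRing J] (X : Finset V) :
    GenericallyGood (⊤ : Sublattice (Submodule J V)) (Submodule.span J (X : Set V)) := by
  refine ⟨trivial, fun W _ hW => ?_, fun L _ hL => ?_⟩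
  · have : IsNoetherian J (Submodule.span J (X : Set V)) :=
      isNoetherian_span_of_finite J X.finite_toSet
    obtain ⟨n, hn⟩ := monotone_stabilizes_iff_noetherian.2 this
      ⟨fun n => (W n).comap (Submodule.span J (X : Set V)).subtype,
        fun a b hab => Submodule.comap_mono (W.monotone hab)⟩
    refine ⟨n, fun m hm => ?_⟩
    have h := congrArg (Submodule.map (Submodule.span J (X : Set V)).subtype) (hn m hm)
    change Submodule.map _ (Submodule.comap _ _) = Submodule.map _ (Submodule.comap _ _) at h
    rwa [Submodule.map_comap_subtype, Submodule.map_comap_subtype, inf_eq_right.2 (hW n), inf_eq_right.2 (hW m), eq_comm] at h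
  · have := genericallyReduced_sup_span L X
    rwa [sup_eq_right.2 hL] at this

end Generic

section ChainGood

variable {J V Q : Type*} [CommRing J] [AddCommGroup V] [Module J V] [Group Q]

/-- The submodules invariant under the action of the subgroup `H`. -/
def invariantSublattice (ρ : Q →* (V ≃ₗ[J] V)) (H : Subgroup Q) :
    Sublattice (Submodule J V) where
  carrier := {U | ∀ h ∈ H, ∀ u ∈ U, ρ h u ∈ U}
  supClosed' := by
    intro U hU W hW h hh u hu
    obtain ⟨a, ha, b, hb, rfl⟩ := Submodule.mem_sup.1 hu
    rw [map_add]
    exact Submodule.add_mem_sup (hU h hh a ha) (hW h hh b hb)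
  infClosed' := fun U hU W hW h hh u hu => ⟨hU h hh u hu.1, hW h hh u hu.2⟩

theorem mem_invariantSublattice {ρ : Q →* (V ≃ₗ[J] V)} {H : Subgroup Q} {U : Submodule J V} :
    U ∈ invariantSublattice ρ H ↔ ∀ h ∈ H, ∀ u ∈ U, ρ h u ∈ U := Iff.rfl

theorem iSup_apply_mem {ι : Sort*} (y : V ≃ₗ[J] V) {F : ι → Submodule J V}
    (hF : ∀ i, ∀ u ∈ F i, y u ∈ F i) : ∀ u ∈ ⨆ i, F i, y u ∈ ⨆ i, F i := by
  intro u hu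
  exact (iSup_le fun i v hv => (le_iSup F i) (hF i v hv) :
    ⨆ i, F i ≤ (⨆ i, F i).comap y.toLinearMap) hu

theorem map_mem_invariantSublattice {ρ : Q →* (V ≃ₗ[J] V)} {H : Subgroup Q} [hH : H.Normal]
    (x : Q) {U : Submodule J V} (hU : U ∈ invariantSublattice ρ H) :
    U.map (ρ x).toLinearMap ∈ invariantSublattice ρ H := by
  rintro h hh _ ⟨u, hu, rfl⟩
  refine ⟨ρ (x⁻¹ * h * x) u, hU _ (by simpa using hH.conj_mem h hh x⁻¹) u hu, ?_⟩
  change ρ x (ρ (x⁻¹ * h * x) u) = ρ h (ρ x u)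
  rw [← LinearEquiv.mul_apply, ← LinearEquiv.mul_apply, ← map_mul, ← map_mul]
  congr 2
  group

theorem comap_mem_invariantSublattice {ρ : Q →* (V ≃ₗ[J] V)} {H : Subgroup Q} [hH : H.Normal]
    (x : Q) {U : Submodule J V} (hU : U ∈ invariantSublattice ρ H) :
    U.comap (ρ x).toLinearMap ∈ invariantSublattice ρ H := by
  intro h hh u hu
  have := hU _ (hH.conj_mem h hh x) _ hu
  change ρ (x * h * x⁻¹) (ρ x u) ∈ U at this
  change ρ x (ρ h u) ∈ U
  rw [← LinearEquiv.mul_apply, ← map_mul] at this ⊢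
  simpa using this

theorem stableSublattice_invariantSublattice (ρ : Q →* (V ≃ₗ[J] V)) (H : Subgroup Q) (x : Q) :
    stableSublattice (stableSublattice (invariantSublattice ρ H) (ρ x)) (ρ x⁻¹) =
      invariantSublattice ρ (H ⊔ Subgroup.zpowers x) := by
  refine SetLike.ext fun U => ?_
  simp only [mem_stableSublattice, mem_invariantSublattice]
  constructor
  · rintro ⟨⟨hH, hx⟩, hx'⟩ h hh
    rw [Subgroup.zpowers_eq_closure, ← Subgroup.closure_eq H, ← Subgroup.closure_union] at hh
    have hgen : ∀ y ∈ (H : Set Q) ∪ {x}, (∀ u ∈ U, ρ y u ∈ U) ∧ ∀ u ∈ U, ρ y⁻¹ u ∈ U := by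
      rintro y (hy | rfl)
      · exact ⟨hH y hy, hH _ (H.inv_mem hy)⟩
      · exact ⟨hx, hx'⟩
    suffices h' : (∀ u ∈ U, ρ h u ∈ U) ∧ ∀ u ∈ U, ρ h⁻¹ u ∈ U from h'.1
    induction hh using Subgroup.closure_induction with
    | mem y hy => exact hgen y hy
    | one => simp
    | mul a b _ _ ha hb =>
      refine ⟨fun u hu => ?_, fun u hu => ?_⟩
      · rw [map_mul]; exact ha.1 _ (hb.1 u hu)
      · rw [mul_inv_rev, map_mul]; exact hb.2 _ (ha.2 u hu)
    | inv a _ ha => rw [inv_inv]; exact ha.symm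
  · intro h
    have hx : x ∈ H ⊔ Subgroup.zpowers x :=
      Subgroup.mem_sup_right (Subgroup.mem_zpowers x)
    exact ⟨⟨fun y hy => h y (Subgroup.mem_sup_left hy), h x hx⟩, h _ (Subgroup.inv_mem _ hx)⟩

theorem le_orbitSpan (x : V ≃ₗ[J] V) (U : Submodule J V) : U ≤ orbitSpan x U := fun u hu =>
  (le_iSup (fun n : ℕ => U.map (x ^ n : V ≃ₗ[J] V).toLinearMap) 0) ⟨u, hu, rfl⟩

theorem CentralChain.exists_genericallyGood [IsDomain J] [IsNoetherianRing J]
    (ρ : Q →* (V ≃ₗ[J] V)) {H : Subgroup Q} (hH : CentralChain H) (X : Finset V) :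
    ∃ U : Submodule J V, (X : Set V) ⊆ U ∧ GenericallyGood (invariantSublattice ρ H) U := by
  induction hH with
  | bot =>
    refine ⟨Submodule.span J X, Submodule.subset_span, ?_⟩
    have : invariantSublattice ρ (⊥ : Subgroup Q) = ⊤ := by
      refine SetLike.ext fun U => ?_
      simp [mem_invariantSublattice]
    rw [this]
    exact genericallyGood_top_span X
  | step H x hH _ ih =>
    have hHn := hH.normal
    obtain ⟨U, hXU, hU⟩ := ih
    have h1 := hU.orbitSpan (x := ρ x) (fun W hW => map_mem_invariantSublattice x hW)
      (fun W hW => comap_mem_invariantSublattice x hW) (fun h hh => iSup_apply_mem _ fun n =>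
        map_pow_mem (fun W hW => map_mem_invariantSublattice x hW) hU.mem n h hh)
    have hxx : ∀ u, ρ x (ρ x⁻¹ u) = u := fun u => by
      rw [← LinearEquiv.mul_apply, ← map_mul]; simp
    have hxx' : ∀ u, ρ x⁻¹ (ρ x u) = u := fun u => by
      rw [← LinearEquiv.mul_apply, ← map_mul]; simp
    have hmap : ∀ W ∈ stableSublattice (invariantSublattice ρ H) (ρ x),
        W.map (ρ x⁻¹).toLinearMap ∈ stableSublattice (invariantSublattice ρ H) (ρ x) := by
      rintro W ⟨hW, hxW⟩
      refine ⟨map_mem_invariantSublattice _ hW, ?_⟩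
      rintro _ ⟨u, hu, rfl⟩
      exact ⟨ρ x u, hxW u hu, (hxx' u).trans (hxx u).symm⟩
    have h2 := h1.orbitSpan (x := ρ x⁻¹) hmap
      (fun W hW => ⟨comap_mem_invariantSublattice _ hW.1, fun u hu => by
        change ρ x⁻¹ (ρ x u) ∈ W
        rw [hxx', ← hxx u]
        exact hW.2 _ hu⟩)
      ⟨fun h hh => iSup_apply_mem _ fun n => (map_pow_mem hmap h1.mem n).1 h hh,
        iSup_apply_mem _ fun n => (map_pow_mem hmap h1.mem n).2⟩
    rw [stableSublattice_invariantSublattice] at h2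
    exact ⟨_, (hXU.trans (le_orbitSpan _ _)).trans (le_orbitSpan _ _), h2⟩

end ChainGood

section GroupRing

variable {Q V : Type*} [Group Q] [AddCommGroup V] [Module (MonoidAlgebra ℤ Q) V]

/-- The action of the group on a module over its group ring, by automorphisms over any ring of
scalars commuting with the group ring. -/
noncomputable def groupAction (J Q V : Type*) [CommRing J] [Group Q] [AddCommGroup V] [Module J V]
    [Module (MonoidAlgebra ℤ Q) V] [SMulCommClass (MonoidAlgebra ℤ Q) J V] : Q →* (V ≃ₗ[J] V) :=
  (LinearMap.GeneralLinearGroup.generalLinearEquiv J V).toMonoidHom.comp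
    (MonoidHom.toHomUnits
      ((Module.toModuleEnd J (S := MonoidAlgebra ℤ Q) V).toMonoidHom.comp (MonoidAlgebra.of ℤ Q)))

theorem smul_mem_of_forall_of_smul_mem (U : AddSubgroup V)
    (hU : ∀ q : Q, ∀ u ∈ U, MonoidAlgebra.of ℤ Q q • u ∈ U) (r : MonoidAlgebra ℤ Q) {u : V}
    (hu : u ∈ U) : r • u ∈ U := by
  induction r using MonoidAlgebra.induction_on with
  | of q => exact hU q u hu
  | add a b ha hb => rw [add_smul]; exact U.add_mem ha hb
  | smul n a ha => rw [smul_assoc]; exact U.zsmul_mem ha n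

theorem CentralChain.exists_genericallyGood_top {J : Type*} [CommRing J] [IsDomain J]
    [IsNoetherianRing J] [Module J V] [SMulCommClass (MonoidAlgebra ℤ Q) J V]
    (hQ : CentralChain (⊤ : Subgroup Q)) [Module.Finite (MonoidAlgebra ℤ Q) V] :
    GenericallyGood (invariantSublattice (groupAction J Q V) ⊤) ⊤ := by
  obtain ⟨X, hX⟩ := (Module.Finite.fg_top : (⊤ : Submodule (MonoidAlgebra ℤ Q) V).FG)
  obtain ⟨U, hXU, hU⟩ := hQ.exists_genericallyGood (groupAction J Q V) X
  have hUtop : U = ⊤ := by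
    let U' : Submodule (MonoidAlgebra ℤ Q) V :=
      { U.toAddSubgroup with
        smul_mem' := fun r u hu => smul_mem_of_forall_of_smul_mem U.toAddSubgroup
          (fun q u hu => hU.mem q (Subgroup.mem_top q) u hu) r hu }
    have : (⊤ : Submodule (MonoidAlgebra ℤ Q) V) ≤ U' := hX ▸ Submodule.span_le.2 hXU
    exact eq_top_iff.2 fun v _ => this (Submodule.mem_top : v ∈ ⊤)
  exact hUtop ▸ hU

theorem CentralChain.isNoetherianRing (hQ : CentralChain (⊤ : Subgroup Q)) :
    IsNoetherianRing (MonoidAlgebra ℤ Q) := by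
  have h := hQ.exists_genericallyGood_top (J := ℤ) (V := MonoidAlgebra ℤ Q)
  refine monotone_stabilizes_iff_noetherian.1 fun W => ?_
  obtain ⟨n, hn⟩ := h.acc
    ⟨fun n => (W n).toAddSubgroup.toIntSubmodule, fun i j hij v hv => W.monotone hij hv⟩
    (fun n q _ u hu => (W n).smul_mem _ hu) (fun n => le_top)
  refine ⟨n, fun m hm => SetLike.ext fun v => ?_⟩
  have := SetLike.ext_iff.1 (hn m hm) v
  exact this.symm

theorem CentralChain.exists_not_surjective_of_domain {J : Type*} [CommRing J] [IsDomain J]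
    [IsNoetherianRing J] [IsJacobsonRing J] [Module J V] [SMulCommClass (MonoidAlgebra ℤ Q) J V]
    (hQ : CentralChain (⊤ : Subgroup Q)) [Module.Finite (MonoidAlgebra ℤ Q) V]
    {x : J} (hx : x ≠ 0) (v : V) (hv : ∀ j : J, j • v = 0 → j = 0) :
    ∃ j : J, ¬ Function.Surjective fun w : V => (1 - x * j) • w := by
  by_contra! hsurj
  obtain ⟨g, hg, hred⟩ := (hQ.exists_genericallyGood_top (J := J) (V := V)).reduced ⊥
    (fun q _ u hu => by rw [(Submodule.mem_bot J).1 hu, map_zero]; exact Submodule.zero_mem _) le_top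
  obtain ⟨m, hm, hmx⟩ : ∃ m : Ideal J, m.IsMaximal ∧ x * g ∉ m := by
    by_contra! hall
    have : x * g ∈ Ideal.jacobson (⊥ : Ideal J) :=
      Ideal.mem_sInf.2 fun {m} hm => hall m hm.2
    rw [IsJacobsonRing.out ‹_› (Ideal.isPrime_bot (α := J)).isRadical] at this
    exact mul_ne_zero hx hg this
  obtain ⟨j, hj⟩ := hm.exists_inv hmx
  obtain ⟨i, hi, hji⟩ := hj
  have hf : 1 - x * (g * j) = i := by rw [← hji]; ring
  have hf0 : i ≠ 0 := by
    intro h0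
    obtain ⟨w, hw⟩ := hsurj (g * j) v
    simp only [hf, h0, zero_smul] at hw
    exact one_ne_zero (hv 1 (by rw [← hw, smul_zero]))
  have hfu : ¬ IsUnit i := fun h => hm.ne_top (Ideal.eq_top_of_isUnit_mem _ hi h)
  obtain ⟨k, hk⟩ := (hred i hf0 hfu ⟨-(x * j), by rw [← hf]; ring⟩).torsion ⊤ bot_le le_top
    (fun d _ => by
      obtain ⟨w, hw⟩ := hsurj (g * j) d
      exact ⟨w, trivial, by simp only [hf] at hw; rw [hw, sub_self]; exact Submodule.zero_mem _⟩)
    v trivial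
  exact hg (eq_zero_of_pow_eq_zero (hv _ ((Submodule.mem_bot J).1 hk)))

theorem CentralChain.exists_not_surjective {J : Type*} [CommRing J]
    [IsNoetherianRing J] [IsJacobsonRing J] [Module J V] [SMulCommClass (MonoidAlgebra ℤ Q) J V]
    (hQ : CentralChain (⊤ : Subgroup Q)) [Module.Finite (MonoidAlgebra ℤ Q) V] [Nontrivial V]
    {x : J} (hx : ∀ v : V, x • v = 0 → v = 0) :
    ∃ j : J, ¬ Function.Surjective fun w : V => (1 - x * j) • w := by
  by_contra! hsurj
  have hN := hQ.isNoetherianRing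
  obtain ⟨p, hp⟩ := associatedPrimes.nonempty J V
  obtain ⟨hprime, v, hpv⟩ := isAssociatedPrime_iff.1 hp
  have hmem : ∀ j, j ∈ p ↔ j • v = 0 := fun j => by
    rw [hpv, Submodule.mem_colon_singleton, Submodule.mem_bot]
  let W : Submodule (MonoidAlgebra ℤ Q) V :=
    { carrier := {w | ∀ j ∈ p, j • w = 0}
      zero_mem' := fun j _ => smul_zero j
      add_mem' := fun {a b} ha hb j hj => by rw [smul_add, ha j hj, hb j hj, add_zero]
      smul_mem' := fun r w hw j hj => by rw [← smul_comm, hw j hj, smul_zero] }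
  let φ : J →+* Module.End (MonoidAlgebra ℤ Q) W :=
    { toFun := fun j =>
        { toFun := fun w => ⟨j • w.1, fun i hi => by rw [smul_comm, w.2 i hi, smul_zero]⟩
          map_add' := fun a b => Subtype.ext (smul_add j a.1 b.1)
          map_smul' := fun r a => Subtype.ext (smul_comm r j a.1).symm }
      map_one' := by ext w; exact one_smul J w.1
      map_mul' := fun i j => by ext w; exact mul_smul i j w.1
      map_zero' := by ext w; exact zero_smul J w.1
      map_add' := fun i j => by ext w; exact add_smul i j w.1 }
  let ψ : J ⧸ p →+* Module.End (MonoidAlgebra ℤ Q) W :=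
    Ideal.Quotient.lift p φ fun j hj => by ext w; exact w.2 j hj
  let _ : Module (J ⧸ p) W := Module.compHom W ψ
  have hsmul : ∀ (j : J) (w : W), ((Ideal.Quotient.mk p j • w : W) : V) = j • w.1 := fun j w => rfl
  have : SMulCommClass (MonoidAlgebra ℤ Q) (J ⧸ p) W := ⟨fun r i w => ((ψ i).map_smul r w).symm⟩
  have hxp : Ideal.Quotient.mk p x ≠ 0 := fun h0 => by
    have hv0 := hx v ((hmem x).1 (Ideal.Quotient.eq_zero_iff_mem.1 h0))
    exact hprime.ne_top ((Ideal.eq_top_iff_one p).2 ((hmem 1).2 (by rw [hv0, smul_zero])))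
  obtain ⟨j, hj⟩ := hQ.exists_not_surjective_of_domain (V := W) hxp
    ⟨v, fun j hj => (hmem j).1 hj⟩ (fun i hi => by
      obtain ⟨i, rfl⟩ := Ideal.Quotient.mk_surjective i
      exact Ideal.Quotient.eq_zero_iff_mem.2 ((hmem i).2 (congrArg Subtype.val hi)))
  obtain ⟨j, rfl⟩ := Ideal.Quotient.mk_surjective j
  refine hj fun w => ?_
  obtain ⟨u, hu⟩ := hsurj j w.1
  let F : Module.End (MonoidAlgebra ℤ Q) V :=
    { toFun := fun w => (1 - x * j) • w
      map_add' := smul_add _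
      map_smul' := fun r w => (smul_comm r _ w).symm }
  have hinj : Function.Injective F :=
    IsNoetherian.injective_of_surjective_endomorphism F (hsurj j)
  refine ⟨⟨u, fun i hi => hinj ?_⟩, Subtype.ext hu⟩
  rw [map_zero]
  change (1 - x * j) • i • u = 0
  rw [smul_comm]
  exact (congrArg (i • ·) hu).trans (w.2 i hi)

end GroupRing

section FixedFiltration

open MonoidAlgebra

variable {Q V : Type*} [Group Q] [AddCommGroup V] [Module (MonoidAlgebra ℤ Q) V]

/-- The largest submodule on which `H` acts trivially modulo `W`. -/
def fixedMod (H : Subgroup Q) (W : Submodule (MonoidAlgebra ℤ Q) V) :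
    Submodule (MonoidAlgebra ℤ Q) V where
  carrier := {v | ∀ r : MonoidAlgebra ℤ Q, ∀ h ∈ H, of ℤ Q h • r • v - r • v ∈ W}
  zero_mem' := fun r h _ => by simp
  add_mem' := fun {a b} ha hb r h hh => by
    have := W.add_mem (ha r h hh) (hb r h hh)
    rwa [sub_add_sub_comm, ← smul_add, ← smul_add] at this
  smul_mem' := fun s v hv r h hh => by
    have := hv (r * s) h hh
    rwa [mul_smul] at this

theorem mem_fixedMod {H : Subgroup Q} [hH : H.Normal] {W : Submodule (MonoidAlgebra ℤ Q) V}
    {v : V} : v ∈ fixedMod H W ↔ ∀ h ∈ H, of ℤ Q h • v - v ∈ W := by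
  refine ⟨fun hv h hh => by simpa using hv 1 h hh, fun hv r => ?_⟩
  let U : AddSubgroup V :=
    { carrier := {v | ∀ h ∈ H, of ℤ Q h • v - v ∈ W}
      zero_mem' := fun h _ => by simp
      add_mem' := fun {a b} ha hb h hh => by
        have := W.add_mem (ha h hh) (hb h hh)
        rwa [sub_add_sub_comm, ← smul_add] at this
      neg_mem' := fun {a} ha h hh => by
        have := W.neg_mem (ha h hh)
        rwa [neg_sub', ← smul_neg] at this }
  refine smul_mem_of_forall_of_smul_mem U (fun q u hu h hh => ?_) r hv
  have := W.smul_mem (of ℤ Q q) (hu (q⁻¹ * h * q) (by simpa using hH.conj_mem h hh q⁻¹))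
  rwa [smul_sub, ← mul_smul, ← map_mul, mul_assoc q⁻¹, mul_inv_cancel_left, map_mul,
    mul_smul] at this

theorem mem_fixedMod_of_mem (H : Subgroup Q) {W : Submodule (MonoidAlgebra ℤ Q) V} {v : V}
    (hv : v ∈ W) : v ∈ fixedMod H W := fun _ _ _ =>
  W.sub_mem (W.smul_mem _ (W.smul_mem _ hv)) (W.smul_mem _ hv)

theorem mem_fixedMod_closure {S : Set Q} [hH : (Subgroup.closure S).Normal]
    {W : Submodule (MonoidAlgebra ℤ Q) V} {v : V} (hS : ∀ s ∈ S, of ℤ Q s • v - v ∈ W) :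
    v ∈ fixedMod (Subgroup.closure S) W := by
  refine mem_fixedMod.2 fun h hh => ?_
  induction hh using Subgroup.closure_induction with
  | mem s hs => exact hS s hs
  | one => rw [map_one, one_smul, sub_self]; exact W.zero_mem
  | mul a b _ _ ha hb =>
    have := W.add_mem (W.smul_mem (of ℤ Q a) hb) ha
    rwa [smul_sub, ← mul_smul, ← map_mul, sub_add_sub_cancel] at this
  | inv a _ ha =>
    have := W.smul_mem (of ℤ Q a⁻¹) ha
    rw [smul_sub, ← mul_smul, ← map_mul, inv_mul_cancel, map_one, one_smul] at this
    simpa using W.neg_mem this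

/-- The upper central filtration of `V` with respect to the action of `H`. -/
noncomputable def fixedFiltration (V : Type*) [AddCommGroup V] [Module (MonoidAlgebra ℤ Q) V] (H : Subgroup Q) :
    ℕ → Submodule (MonoidAlgebra ℤ Q) V
  | 0 => ⊥
  | n + 1 => fixedMod H (fixedFiltration V H n)

theorem fixedFiltration_monotone (H : Subgroup Q) : Monotone (fixedFiltration V H) :=
  monotone_nat_of_le_succ fun _ _ hv => mem_fixedMod_of_mem H hv

theorem map_fixedFiltration_le {V' : Type*} [AddCommGroup V'] [Module (MonoidAlgebra ℤ Q) V']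
    (φ : V →ₗ[MonoidAlgebra ℤ Q] V') (H : Subgroup Q) (n : ℕ) :
    ∀ v ∈ fixedFiltration V H n, φ v ∈ fixedFiltration V' H n := by
  induction n with
  | zero => exact fun v hv => by simp [(Submodule.mem_bot _).1 hv, fixedFiltration]
  | succ n ih =>
    intro v hv r h hh
    have := ih _ (hv r h hh)
    rwa [map_sub, map_smul, map_smul] at this

/-- Every vector lies in a finite stage of the upper central filtration. -/
def LocallyUnipotent (V : Type*) [AddCommGroup V] [Module (MonoidAlgebra ℤ Q) V]
    (H : Subgroup Q) : Prop := ∀ v : V, ∃ n, v ∈ fixedFiltration V H n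

theorem CentralChain.exists_critical {K : Subgroup Q} (hK : CentralChain K)
    (hV : ¬ LocallyUnipotent V K) : ∃ (H : Subgroup Q) (x : Q), CentralChain H ∧
      (∀ q, ⁅x, q⁆ ∈ H) ∧ LocallyUnipotent V H ∧
      ¬ LocallyUnipotent V (H ⊔ Subgroup.zpowers x) := by
  induction hK with
  | bot =>
    refine absurd (fun v => ⟨1, fun r h hh => ?_⟩) hV
    rw [Subgroup.mem_bot.1 hh, map_one, one_smul, sub_self]
    exact Submodule.zero_mem _
  | step H x hH hx ih =>
    by_cases h : LocallyUnipotent V H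
    · exact ⟨H, x, hH, hx, h, hV⟩
    · exact ih h

theorem commutator_mem_of_inv_mul_mem {H : Subgroup Q} [hH : H.Normal] {x y : Q}
    (hx : ∀ q, ⁅x, q⁆ ∈ H) (hy : x⁻¹ * y ∈ H) (q : Q) : ⁅y, q⁆ ∈ H := by
  have hxq := mem_centralizerMod_comm.1 (mem_centralizerMod.2 (hx q))
  have hyq : x⁻¹ * y ∈ centralizerMod H q :=
    mem_centralizerMod.2 (by
      rw [commutatorElement_def]
      exact H.mul_mem (hH.conj_mem _ hy q) (H.inv_mem hy))
  have := Subgroup.mul_mem _ hxq hyq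
  rw [mul_inv_cancel_left] at this
  exact mem_centralizerMod.1 (mem_centralizerMod_comm.1 this)

theorem of_smul_comm_of_fixed {H : Subgroup Q} {y : Q} (hy : ∀ q, ⁅y, q⁆ ∈ H)
    {M : Submodule (MonoidAlgebra ℤ Q) V} (hM : ∀ h ∈ H, ∀ v ∈ M, of ℤ Q h • v = v)
    (r : MonoidAlgebra ℤ Q) {v : V} (hv : v ∈ M) : of ℤ Q y • r • v = r • of ℤ Q y • v := by
  induction r using MonoidAlgebra.induction_on with
  | of q =>
    have h1 := hM _ (hy q) (of ℤ Q (q * y) • v) (M.smul_mem _ hv)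
    rw [← mul_smul, ← map_mul, commutatorElement_def] at h1
    rw [← mul_smul, ← map_mul, ← mul_smul, ← map_mul, ← h1]
    simp only [mul_assoc, inv_mul_cancel_left, inv_mul_cancel, mul_one]
  | add a b ha hb => rw [add_smul, smul_add, ha, hb, add_smul]
  | smul n a ha => rw [smul_assoc, smul_assoc, smul_comm, ha]

/-- Translation by `y` minus the identity, as an endomorphism of a submodule on which `y` acts
centrally. -/
noncomputable def subOneEnd {H : Subgroup Q} {y : Q} (hy : ∀ q, ⁅y, q⁆ ∈ H)
    {M : Submodule (MonoidAlgebra ℤ Q) V} (hM : ∀ h ∈ H, ∀ v ∈ M, of ℤ Q h • v = v) :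
    Module.End (MonoidAlgebra ℤ Q) M where
  toFun v := (of ℤ Q y - 1) • v
  map_add' := smul_add _
  map_smul' r v := Subtype.ext <| by
    simp only [RingHom.id_apply, Submodule.coe_smul, sub_smul, smul_sub, one_smul,
      of_smul_comm_of_fixed hy hM r v.2]

theorem aeval_subOneEnd {H : Subgroup Q} {y : Q} (hy : ∀ q, ⁅y, q⁆ ∈ H)
    {M : Submodule (MonoidAlgebra ℤ Q) V} (hM : ∀ h ∈ H, ∀ v ∈ M, of ℤ Q h • v = v)
    (f : Polynomial ℤ) (v : M) :
    Polynomial.aeval (subOneEnd hy hM) f v = Polynomial.aeval (of ℤ Q y - 1) f • v := by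
  induction f using Polynomial.induction_on' generalizing v with
  | add a b ha hb => rw [map_add, map_add, LinearMap.add_apply, ha, hb, add_smul]
  | monomial n a =>
    rw [Polynomial.aeval_monomial, Polynomial.aeval_monomial]
    simp only [eq_intCast, Module.End.mul_apply]
    rw [mul_smul]
    have : ∀ n : ℕ, ∀ v : M, (subOneEnd hy hM ^ n) v = (of ℤ Q y - 1) ^ n • v := by
      intro n
      induction n with
      | zero => simp
      | succ n ih => intro v; rw [pow_succ, pow_succ, Module.End.mul_apply, ih, mul_smul]; rfl
    rw [this, Module.End.intCast_apply, Int.cast_smul_eq_zsmul]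

theorem isJacobsonRing_int : IsJacobsonRing ℤ := by
  refine isJacobsonRing_iff_prime_eq.2 fun P hP => ?_
  rcases eq_or_ne P ⊥ with rfl | hP0
  · refine (eq_bot_iff.2 fun x hx => ?_)
    have := Int.isUnit_iff.1 (Ideal.mem_jacobson_bot.1 hx x)
    have hx0 : x * x = 0 := by
      have := mul_self_nonneg x
      lia
    simpa using hx0
  · have := hP.isMaximal hP0
    exact Ideal.jacobson_eq_self_of_isMaximal

theorem CentralChain.exists_polynomial_not_surjective (hQ : CentralChain (⊤ : Subgroup Q))
    [Module.Finite (MonoidAlgebra ℤ Q) V] [Nontrivial V] (t : Module.End (MonoidAlgebra ℤ Q) V)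
    (ht : Function.Injective t) : ∃ f : Polynomial ℤ, f.eval 0 = 1 ∧
      ¬ Function.Surjective (Polynomial.aeval t f) := by
  let _ : Module (Polynomial ℤ) V := Module.compHom V (Polynomial.aeval (R := ℤ) t).toRingHom
  have hsmul : ∀ (f : Polynomial ℤ) (v : V), f • v = Polynomial.aeval t f v := fun _ _ => rfl
  have : SMulCommClass (MonoidAlgebra ℤ Q) (Polynomial ℤ) V :=
    ⟨fun r f v => ((Polynomial.aeval t f).map_smul r v).symm⟩
  have := isJacobsonRing_int
  obtain ⟨j, hj⟩ := hQ.exists_not_surjective (V := V) (x := (Polynomial.X : Polynomial ℤ))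
    fun v hv => ht (by rw [hsmul, Polynomial.aeval_X] at hv; rw [hv, map_zero])
  exact ⟨1 - Polynomial.X * j, by simp, hj⟩

end FixedFiltration

section Annihilation

open MonoidAlgebra Polynomial

variable {Q V : Type*} [Group Q] [AddCommGroup V] [Module (MonoidAlgebra ℤ Q) V]

theorem exists_polynomial_smul_eq_zero_of_fixed [IsNoetherianRing (MonoidAlgebra ℤ Q)]
    {H : Subgroup Q} {y : Q} (hy : ∀ q, ⁅y, q⁆ ∈ H) {d : V} (hd : d ≠ 0)
    (hmin : ∀ W : Submodule (MonoidAlgebra ℤ Q) V, W ≠ ⊥ → d ∈ W)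
    {f : ℤ[X]} (hf : f.eval 0 = 1) (hfd : aeval (of ℤ Q y - 1) f • d = 0)
    {v : V} (hv : v ∈ fixedFiltration V H 1) :
    ∃ g : ℤ[X], g.eval 0 = 1 ∧ aeval (of ℤ Q y - 1) g • v = 0 := by
  set M : Submodule (MonoidAlgebra ℤ Q) V := Submodule.span _ {v} with hMdef
  have hM : ∀ h ∈ H, ∀ u ∈ M, of ℤ Q h • u = u := by
    intro h hh u hu
    obtain ⟨r, rfl⟩ := Submodule.mem_span_singleton.1 hu
    exact sub_eq_zero.1 ((Submodule.mem_bot _).1 (hv r h hh))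
  set s := aeval (subOneEnd hy hM) f with hs
  have hsM : ∀ (k : ℕ) (u : M), (((s ^ k) u : M) : V) = aeval (of ℤ Q y - 1) (f ^ k) • u.1 := by
    intro k u
    rw [hs, ← map_pow, aeval_subOneEnd]
    rfl
  have hNM : IsNoetherian (MonoidAlgebra ℤ Q) M :=
    isNoetherian_of_fg_of_noetherian M ⟨{v}, by simp [hMdef]⟩
  obtain ⟨k, hk⟩ := Filter.eventually_atTop.1 s.eventually_disjoint_ker_pow_range_pow
  have hdis := hk (k + 1) (Nat.le_succ k)
  have hrange : (LinearMap.range (s ^ (k + 1))).map M.subtype = ⊥ := by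
    by_contra hne
    obtain ⟨u, hu, hud⟩ := hmin _ hne
    have hu0 : u = 0 := by
      refine (Submodule.mem_bot (MonoidAlgebra ℤ Q)).1 (hdis.le_bot ⟨LinearMap.mem_ker.2 ?_, hu⟩)
      refine Subtype.ext ((hsM _ _).trans ?_)
      rw [pow_succ, map_mul, mul_smul]
      change _ • _ • (M.subtype u) = 0
      rw [hud, hfd, smul_zero]
    exact hd (by rw [← hud, hu0, map_zero])
  refine ⟨f ^ (k + 1), by simp [hf], ?_⟩
  rw [← hsM _ ⟨v, Submodule.mem_span_singleton_self v⟩]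
  exact (Submodule.mem_bot (MonoidAlgebra ℤ Q)).1 (hrange ▸ ⟨_, ⟨_, rfl⟩, rfl⟩)

theorem exists_polynomial_of_mem_upperCentralSeries {H : Subgroup Q} [hH : H.Normal] (y : Q) (n : ℕ)
    (ih : ∀ v ∈ fixedFiltration V H (n + 1),
      ∃ f : ℤ[X], f.eval 0 = 1 ∧ aeval (of ℤ Q y - 1) f • v ∈ fixedFiltration V H n)
    {v : V} (hv : v ∈ fixedFiltration V H (n + 2)) (j : ℕ) :
    ∀ h ∈ H, h ∈ Subgroup.upperCentralSeries Q j → ∃ f : ℤ[X], f.eval 0 = 1 ∧ ∀ k : ℤ[X],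
      (of ℤ Q h - 1) • aeval (of ℤ Q y - 1) (k * f) • v ∈ fixedFiltration V H n := by
  induction j with
  | zero =>
    intro h _ h1
    refine ⟨1, by simp, fun k => ?_⟩
    rw [Subgroup.upperCentralSeries_zero, Subgroup.mem_bot] at h1
    rw [h1, map_one, sub_self, zero_smul]
    exact Submodule.zero_mem _
  | succ j ihj =>
    intro h hh hhj
    set F := fixedFiltration V H n
    set τ := of ℤ Q y - 1 with hτ
    have hc : h⁻¹ * y⁻¹ * h * y = ⁅h⁻¹, y⁻¹⁆ := by simp [commutatorElement_def]
    obtain ⟨f, hf, hfk⟩ := ihj (h⁻¹ * y⁻¹ * h * y)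
      (by
        have := H.mul_mem (H.inv_mem hh) (hH.conj_mem h hh y⁻¹)
        simpa [mul_assoc] using this)
      (by
        rw [hc]
        exact (Subgroup.mem_upperCentralSeries_succ_iff).1 (Subgroup.inv_mem _ hhj) _)
    have hstep : ∀ u, (of ℤ Q (h⁻¹ * y⁻¹ * h * y) - 1) • u ∈ F →
        (of ℤ Q h - 1) • τ • u - τ • (of ℤ Q h - 1) • u ∈ F := by
      intro u hu
      have := F.smul_mem (of ℤ Q y * of ℤ Q h) hu
      rw [← mul_smul, mul_sub, ← map_mul, ← map_mul] at this
      rw [← mul_smul, ← mul_smul, ← sub_smul]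
      convert this using 2
      rw [show y * h * (h⁻¹ * y⁻¹ * h * y) = h * y by group, hτ, map_mul, map_mul]
      noncomm_ring
    have hcomm : ∀ k : ℤ[X], (of ℤ Q h - 1) • aeval τ k • aeval τ f • v
        - aeval τ k • (of ℤ Q h - 1) • aeval τ f • v ∈ F := by
      intro k
      induction k using Polynomial.induction_on with
      | C a =>
        rw [aeval_C, eq_intCast, Int.cast_smul_eq_zsmul,
          Int.cast_smul_eq_zsmul, smul_comm, sub_self]
        exact F.zero_mem
      | add p q hp hq =>
        have := F.add_mem hp hq
        rwa [sub_add_sub_comm, ← add_smul, ← smul_add, ← add_smul, ← map_add] at this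
      | monomial m a hm =>
        set p : ℤ[X] := C a * X ^ m with hp
        have hpX : (C a * X ^ (m + 1) : ℤ[X]) = X * p := by rw [hp]; ring
        have h1 := hstep (aeval τ p • aeval τ f • v) (by
          rw [← mul_smul (aeval τ p), ← map_mul]; exact hfk p)
        have h2 := F.add_mem h1 (F.smul_mem τ hm)
        rw [smul_sub, sub_add_sub_cancel] at h2
        rw [hpX, map_mul, aeval_X, mul_smul, mul_smul]
        exact h2
    obtain ⟨g, hg, hgk⟩ := ih ((of ℤ Q h - 1) • aeval τ f • v) (by
      rw [sub_smul, one_smul]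
      exact mem_fixedMod.1 ((fixedFiltration V H (n + 2)).smul_mem _ hv) h hh)
    refine ⟨g * f, by simp [hf, hg], fun k => ?_⟩
    have h1 := F.add_mem (hcomm (k * g)) (F.smul_mem (aeval τ k) hgk)
    rw [← mul_smul (aeval τ k), ← map_mul, sub_add_cancel, ← mul_smul (aeval τ (k * g)), ← map_mul,
      mul_assoc] at h1
    exact h1

theorem exists_polynomial_smul_mem [hnil : Group.IsNilpotent Q] {H : Subgroup Q} [hH : H.Normal]
    (hfg : H.FG) (y : Q)
    (hbase : ∀ v ∈ fixedFiltration V H 1,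
      ∃ f : ℤ[X], f.eval 0 = 1 ∧ aeval (of ℤ Q y - 1) f • v = 0) (n : ℕ) :
    ∀ v ∈ fixedFiltration V H (n + 1),
      ∃ f : ℤ[X], f.eval 0 = 1 ∧ aeval (of ℤ Q y - 1) f • v ∈ fixedFiltration V H n := by
  induction n with
  | zero => exact hbase
  | succ n ih =>
    classical
    intro v hv
    obtain ⟨c, hc⟩ := hnil.nilpotent
    obtain ⟨S, rfl⟩ := hfg
    have key : ∀ S' ⊆ S, ∃ f : ℤ[X], f.eval 0 = 1 ∧ ∀ s ∈ S', ∀ k : ℤ[X],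
        (of ℤ Q s - 1) • aeval (of ℤ Q y - 1) (k * f) • v ∈
          fixedFiltration V (Subgroup.closure (S : Set Q)) n := by
      intro S'
      induction S' using Finset.induction_on with
      | empty => exact fun _ => ⟨1, by simp, by simp⟩
      | insert s S' _ ihS =>
        intro hS
        obtain ⟨f, hf, hfk⟩ := ihS ((Finset.subset_insert _ _).trans hS)
        obtain ⟨g, hg, hgk⟩ := exists_polynomial_of_mem_upperCentralSeries y n ih hv c s
          (Subgroup.subset_closure (hS (Finset.mem_insert_self _ _))) (hc ▸ Subgroup.mem_top s)
        refine ⟨f * g, by simp [hf, hg], fun u hu k => ?_⟩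
        rcases Finset.mem_insert.1 hu with rfl | hu
        · rw [← mul_assoc]; exact hgk _
        · rw [mul_comm f, ← mul_assoc]; exact hfk u hu _
    obtain ⟨f, hf, hfk⟩ := key S subset_rfl
    refine ⟨f, hf, mem_fixedMod_closure fun s hs => ?_⟩
    have := hfk s hs 1
    rwa [one_mul, sub_smul, one_smul] at this

theorem exists_polynomial_smul_eq_zero [hnil : Group.IsNilpotent Q] {H : Subgroup Q}
    [hH : H.Normal] (hfg : H.FG) (y : Q) (hV : LocallyUnipotent V H)
    (hbase : ∀ v ∈ fixedFiltration V H 1,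
      ∃ f : ℤ[X], f.eval 0 = 1 ∧ aeval (of ℤ Q y - 1) f • v = 0) (v : V) :
    ∃ f : ℤ[X], f.eval 0 = 1 ∧ aeval (of ℤ Q y - 1) f • v = 0 := by
  obtain ⟨n, hn⟩ := hV v
  induction n generalizing v with
  | zero => exact ⟨1, by simp, by rw [(Submodule.mem_bot _).1 hn, smul_zero]⟩
  | succ n ih =>
    obtain ⟨f, hf, hfv⟩ := exists_polynomial_smul_mem hfg y hbase n v hn
    obtain ⟨g, hg, hgv⟩ := ih _ hfv
    exact ⟨g * f, by simp [hf, hg], by rw [map_mul, mul_smul, hgv]⟩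

theorem sub_smul_bijective_of_polynomial {R : Type*} [Ring R] [Module R V] (τ : R)
    (h : ∀ v : V, ∃ f : ℤ[X], f.eval 0 = 1 ∧ aeval τ f • v = 0) :
    (∀ v : V, τ • v = 0 → v = 0) ∧ ∀ v : V, ∃ w : V, τ • w = v := by
  have key : ∀ f : ℤ[X], f.eval 0 = 1 → ∃ g : ℤ[X], f = X * g + 1 := by
    intro f hf
    obtain ⟨g, hg⟩ := X_dvd_sub_C (p := f)
    refine ⟨g, ?_⟩
    rw [← hg, coeff_zero_eq_eval_zero, hf, map_one, sub_add_cancel]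
  refine ⟨fun v hv => ?_, fun v => ?_⟩
  · obtain ⟨f, hf, hfv⟩ := h v
    obtain ⟨g, rfl⟩ := key f hf
    rwa [mul_comm, map_add, map_mul, aeval_X, map_one, add_smul, mul_smul, hv, smul_zero, zero_add,
      one_smul] at hfv
  · obtain ⟨f, hf, hfv⟩ := h v
    obtain ⟨g, rfl⟩ := key f hf
    rw [map_add, map_mul, aeval_X, map_one, add_smul, mul_smul, one_smul] at hfv
    exact ⟨-(aeval τ g • v), by rw [smul_neg]; exact (eq_neg_of_add_eq_zero_right hfv).symm⟩

end Annihilation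

section CriticalQuotient

open MonoidAlgebra Polynomial

variable {Q V : Type*} [Group Q] [AddCommGroup V] [Module (MonoidAlgebra ℤ Q) V]

theorem exists_fixedFiltration_stable [IsNoetherianRing (MonoidAlgebra ℤ Q)] (K : Subgroup Q)
    (v : V) : ∃ n, ∀ u ∈ Submodule.span (MonoidAlgebra ℤ Q) {v},
      u ∈ fixedFiltration V K (n + 1) → u ∈ fixedFiltration V K n := by
  set M := Submodule.span (MonoidAlgebra ℤ Q) {v} with hM
  have hN : IsNoetherian (MonoidAlgebra ℤ Q) M :=
    isNoetherian_of_fg_of_noetherian M ⟨{v}, by simp [hM]⟩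
  obtain ⟨n, hn⟩ := monotone_stabilizes_iff_noetherian.2 hN
    ⟨fun n => (fixedFiltration V K n).comap M.subtype,
      fun i j hij => Submodule.comap_mono (fixedFiltration_monotone K hij)⟩
  refine ⟨n, fun u hu hun => ?_⟩
  have := SetLike.ext_iff.1 (hn (n + 1) (Nat.le_succ n)) ⟨u, hu⟩
  exact this.2 hun

theorem exists_mem_fixedMod_notMem {H : Subgroup Q} (hV : LocallyUnipotent V H)
    {W M : Submodule (MonoidAlgebra ℤ Q) V} (hMW : ¬ M ≤ W) :
    ∃ d ∈ M, d ∉ W ∧ d ∈ fixedMod H W := by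
  classical
  obtain ⟨v, hvM, hvW⟩ := SetLike.not_le_iff_exists.1 hMW
  have hex : ∃ n, ∃ u ∈ M, u ∉ W ∧ u ∈ fixedFiltration V H n :=
    (hV v).imp fun n hn => ⟨v, hvM, hvW, hn⟩
  obtain ⟨d, hdM, hdW, hd⟩ := Nat.find_spec hex
  refine ⟨d, hdM, hdW, fun r h hh => ?_⟩
  rcases hm : Nat.find hex with _ | m
  · rw [hm] at hd
    exact absurd ((Submodule.mem_bot _).1 hd ▸ W.zero_mem) hdW
  · rw [hm] at hd
    by_contra hW
    exact Nat.find_min hex (hm ▸ Nat.lt_succ_self m)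
      ⟨_, M.sub_mem (M.smul_mem _ (M.smul_mem _ hdM)) (M.smul_mem _ hdM), hW, hd r h hh⟩

theorem exists_maximal_notMem {R : Type*} [Ring R] [Module R V] {d : V} {W : Submodule R V}
    (hd : d ∉ W) : ∃ B : Submodule R V, W ≤ B ∧ d ∉ B ∧ ∀ C : Submodule R V, B < C → d ∈ C := by
  obtain ⟨B, hWB, hB⟩ := zorn_le_nonempty₀ {B : Submodule R V | d ∉ B} (fun c hc hch C hC => by
    refine ⟨sSup c, fun hdc => ?_, fun B hB => le_sSup hB⟩
    obtain ⟨B, hB, hdB⟩ := (Submodule.mem_sSup_of_directed ⟨C, hC⟩ hch.directedOn).1 hdc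
    exact hc hB hdB) W hd
  exact ⟨B, hWB, hB.prop, fun C hC => by_contra fun h => hC.not_ge (hB.le_of_ge h hC.le)⟩

theorem CentralChain.exists_critical_quotient (hQ : CentralChain (⊤ : Subgroup Q))
    {H : Subgroup Q} [hHn : H.Normal] {x : Q} (hx : ∀ q, ⁅x, q⁆ ∈ H)
    (hV : LocallyUnipotent V H) (hV' : ¬ LocallyUnipotent V (H ⊔ Subgroup.zpowers x)) :
    ∃ (B : Submodule (MonoidAlgebra ℤ Q) V) (d : V) (f : ℤ[X]), d ∉ B ∧
      (∀ C : Submodule (MonoidAlgebra ℤ Q) V, B < C → d ∈ C) ∧ d ∈ fixedMod H B ∧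
      f.eval 0 = 1 ∧ aeval (of ℤ Q x - 1) f • d ∈ B := by
  have hNR := hQ.isNoetherianRing
  have hKn := normal_sup_zpowers hx
  unfold LocallyUnipotent at hV'
  push Not at hV'
  obtain ⟨v, hv⟩ := hV'
  obtain ⟨n, hn⟩ := exists_fixedFiltration_stable (H ⊔ Subgroup.zpowers x) v
  set W := fixedFiltration V (H ⊔ Subgroup.zpowers x) n with hW
  obtain ⟨d, hdv, hdW, hdH⟩ := exists_mem_fixedMod_notMem hV
    (fun hle => hv n (hle (Submodule.mem_span_singleton_self v)))
  set M : Submodule (MonoidAlgebra ℤ Q) (V ⧸ W) := Submodule.span _ {W.mkQ d} with hMdef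
  have hM : ∀ h ∈ H, ∀ u ∈ M, of ℤ Q h • u = u := by
    intro h hh u hu
    obtain ⟨r, rfl⟩ := Submodule.mem_span_singleton.1 hu
    rw [← sub_eq_zero, ← map_smul, ← map_smul, ← map_sub]
    exact (Submodule.Quotient.mk_eq_zero W).2 (hdH r h hh)
  have hMfin : Module.Finite (MonoidAlgebra ℤ Q) M :=
    Module.Finite.iff_fg.2 ⟨{W.mkQ d}, by simp [hMdef]⟩
  have hdM : W.mkQ d ∈ M := Submodule.mem_span_singleton_self _
  have hMnon : Nontrivial M :=
    ⟨⟨⟨_, hdM⟩, 0, fun h => hdW ((Submodule.Quotient.mk_eq_zero W).1 (congrArg Subtype.val h))⟩⟩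
  have hinj : Function.Injective (subOneEnd hx hM) := by
    refine (injective_iff_map_eq_zero _).2 ?_
    rintro ⟨u, hu⟩ h0
    obtain ⟨r, rfl⟩ := Submodule.mem_span_singleton.1 hu
    have h1 : of ℤ Q x • r • d - r • d ∈ W := by
      have h2 : (of ℤ Q x - 1) • r • W.mkQ d = 0 := congrArg Subtype.val h0
      rw [sub_smul, one_smul] at h2
      exact (Submodule.Quotient.mk_eq_zero W).1 h2
    refine Subtype.ext ((Submodule.Quotient.mk_eq_zero W).2 (hn (r • d)
      (Submodule.smul_mem _ _ hdv) ?_))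
    have hcl : H ⊔ Subgroup.zpowers x = Subgroup.closure ((H : Set Q) ∪ {x}) := by
      rw [Subgroup.closure_union, Subgroup.closure_eq, Subgroup.zpowers_eq_closure]
    change r • d ∈ fixedMod _ W
    have hcn : (Subgroup.closure ((H : Set Q) ∪ {x})).Normal := hcl ▸ hKn
    rw [hcl]
    refine mem_fixedMod_closure ?_
    rintro s (hs | rfl)
    · exact hdH r s hs
    · exact h1
  obtain ⟨f, hf, hsurj⟩ := hQ.exists_polynomial_not_surjective (subOneEnd hx hM) hinj
  set K := LinearMap.range (aeval (subOneEnd hx hM) f)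
  have hdK : d ∉ (K.map M.subtype).comap W.mkQ := by
    rintro ⟨u, hu, hud⟩
    refine hsurj (LinearMap.range_eq_top.1 (eq_top_iff.2 ?_))
    rintro ⟨w, hw⟩ -
    obtain ⟨r, rfl⟩ := Submodule.mem_span_singleton.1 hw
    have := K.smul_mem r hu
    convert this using 1
    exact Subtype.ext (congrArg (r • ·) hud.symm)
  obtain ⟨B, hB, hdB, hBmax⟩ := exists_maximal_notMem hdK
  have hWB : W ≤ B := fun w hw => hB ⟨0, K.zero_mem, by
    rw [map_zero]; exact ((Submodule.Quotient.mk_eq_zero W).2 hw).symm⟩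
  refine ⟨B, d, f, hdB, hBmax, fun r h hh => hWB (hdH r h hh), hf, hB ?_⟩
  exact ⟨_, ⟨⟨_, hdM⟩, rfl⟩, by rw [aeval_subOneEnd]; rfl⟩

/-- A module that is not locally unipotent has a nonzero quotient on which all elements of some
coset, central modulo a normal subgroup, act without fixed points and with full commutator. -/
theorem CentralChain.exists_quotient_sub_bijective (hQ : CentralChain (⊤ : Subgroup Q))
    [hnil : Group.IsNilpotent Q] (hV : ¬ LocallyUnipotent V (⊤ : Subgroup Q)) :
    ∃ (B : Submodule (MonoidAlgebra ℤ Q) V) (N : Subgroup Q) (z : Q), B ≠ ⊤ ∧ N.Normal ∧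
      (∀ q, ⁅z, q⁆ ∈ N) ∧ ∀ y, z⁻¹ * y ∈ N → (∀ v : V, of ℤ Q y • v - v ∈ B → v ∈ B) ∧
        ∀ v : V, ∃ w : V, v - (of ℤ Q y • w - w) ∈ B := by
  obtain ⟨H, x, hH, hx, hVH, hVx⟩ := hQ.exists_critical hV
  have hNR := hQ.isNoetherianRing
  have hHn := hH.normal
  obtain ⟨B, d, f, hdB, hBmax, hdH, hf, hfd⟩ := hQ.exists_critical_quotient hx hVH hVx
  refine ⟨B, H, x, fun h => hdB (h ▸ Submodule.mem_top), hHn, hx, fun y hy => ?_⟩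
  have hy' := commutator_mem_of_inv_mul_mem hx hy
  have hquot : LocallyUnipotent (V ⧸ B) H := fun v => by
    obtain ⟨v, rfl⟩ := B.mkQ_surjective v
    exact (hVH v).imp fun n hn => map_fixedFiltration_le B.mkQ H n v hn
  have hd0 : B.mkQ d ≠ 0 := fun h => hdB ((Submodule.Quotient.mk_eq_zero B).1 h)
  have hmin : ∀ W : Submodule (MonoidAlgebra ℤ Q) (V ⧸ B), W ≠ ⊥ → B.mkQ d ∈ W := by
    intro W hW
    refine hBmax (W.comap B.mkQ) (lt_of_le_not_ge (fun b hb => ?_) fun hle => hW ?_)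
    · rw [Submodule.mem_comap, Submodule.mkQ_apply, (Submodule.Quotient.mk_eq_zero B).2 hb]
      exact W.zero_mem
    · refine eq_bot_iff.2 fun w hw => ?_
      obtain ⟨w, rfl⟩ := B.mkQ_surjective w
      exact (Submodule.Quotient.mk_eq_zero B).2 (hle hw)
  have hxy : ∀ u ∈ Submodule.span (MonoidAlgebra ℤ Q) {B.mkQ d}, (of ℤ Q y - 1) • u =
      (of ℤ Q x - 1) • u := by
    intro u hu
    obtain ⟨r, rfl⟩ := Submodule.mem_span_singleton.1 hu
    have h1 : of ℤ Q (x⁻¹ * y) • r • B.mkQ d = r • B.mkQ d :=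
      sub_eq_zero.1 ((Submodule.Quotient.mk_eq_zero B).2 (hdH r _ hy))
    rw [sub_smul, sub_smul]
    conv_rhs => rw [← h1, ← mul_smul, ← map_mul, mul_inv_cancel_left]
    rw [h1]
  have hfy : aeval (of ℤ Q y - 1) f • B.mkQ d = 0 := by
    have hM : ∀ h ∈ H, ∀ u ∈ Submodule.span (MonoidAlgebra ℤ Q) {B.mkQ d}, of ℤ Q h • u = u := by
      intro h hh u hu
      obtain ⟨r, rfl⟩ := Submodule.mem_span_singleton.1 hu
      exact sub_eq_zero.1 ((Submodule.Quotient.mk_eq_zero B).2 (hdH r h hh))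
    have heq : subOneEnd hy' hM = subOneEnd hx hM :=
      LinearMap.ext fun u => Subtype.ext (hxy u.1 u.2)
    have h1 := aeval_subOneEnd hy' hM f ⟨_, Submodule.mem_span_singleton_self _⟩
    rw [heq, aeval_subOneEnd] at h1
    have h2 : aeval (of ℤ Q x - 1) f • B.mkQ d = 0 := (Submodule.Quotient.mk_eq_zero B).2 hfd
    exact (congrArg Subtype.val h1).symm.trans h2
  obtain ⟨h1, h2⟩ := sub_smul_bijective_of_polynomial (V := V ⧸ B) (of ℤ Q y - 1)
    (exists_polynomial_smul_eq_zero hH.fg y hquot fun v hv =>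
      exists_polynomial_smul_eq_zero_of_fixed hy' hd0 hmin hf hfy hv)
  refine ⟨fun v hv => ?_, fun v => ?_⟩
  · refine (Submodule.Quotient.mk_eq_zero B).1 (h1 (B.mkQ v) ?_)
    rw [sub_smul, one_smul]
    exact (Submodule.Quotient.mk_eq_zero B).2 hv
  · obtain ⟨w, hw⟩ := h2 (B.mkQ v)
    obtain ⟨w, rfl⟩ := B.mkQ_surjective w
    refine ⟨w, (Submodule.Quotient.mk_eq_zero B).1 ?_⟩
    rw [sub_smul, one_smul] at hw
    exact sub_eq_zero.2 hw.symm

end CriticalQuotient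

section Contranormal

variable {G P : Type*} [Group G] [Group P]

theorem eq_of_map_eq_of_mem_upperCentralSeries (π : G →* P) {V W : Subgroup G} {g : G}
    (hgV : g ∈ V) (hgW : g ∈ W) (hV : ∀ v ∈ V, π v = 1 → v = 1) (hW : ∀ w ∈ W, π w = 1 → w = 1)
    (hg : ∀ a, π a = 1 → a * g = g * a → a = 1) (n : ℕ) :
    ∀ v ∈ V, ∀ w ∈ W, π v = π w → π v ∈ Subgroup.upperCentralSeries P n → v = w := by
  induction n with
  | zero =>
    intro v hv w hw hvw h1
    rw [Subgroup.upperCentralSeries_zero, Subgroup.mem_bot] at h1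
    rw [hV v hv h1, hW w hw (hvw ▸ h1)]
  | succ n ih =>
    intro v hv w hw hvw hn
    have hcomm : ⁅v, g⁆ = ⁅w, g⁆ := by
      refine ih _ ?_ _ ?_ (by simp only [map_commutatorElement, hvw]) ?_
      · rw [commutatorElement_def]
        exact V.mul_mem (V.mul_mem (V.mul_mem hv hgV) (V.inv_mem hv)) (V.inv_mem hgV)
      · rw [commutatorElement_def]
        exact W.mul_mem (W.mul_mem (W.mul_mem hw hgW) (W.inv_mem hw)) (W.inv_mem hgW)
      · rw [map_commutatorElement]
        exact Subgroup.mem_upperCentralSeries_succ_iff.1 hn _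
    rw [commutatorElement_def, commutatorElement_def, mul_left_inj] at hcomm
    refine (inv_mul_eq_one.1 (hg (v⁻¹ * w) (by simp [hvw]) ?_))
    calc v⁻¹ * w * g = v⁻¹ * (w * g * w⁻¹) * w := by group
      _ = v⁻¹ * (v * g * v⁻¹) * w := by rw [hcomm]
      _ = g * (v⁻¹ * w) := by group

theorem map_conj_mem_of_commutator_mem {N : Subgroup P} [hN : N.Normal] {z : P}
    (hz : ∀ p, ⁅z, p⁆ ∈ N) (p : P) : z⁻¹ * (p * z * p⁻¹) ∈ N := by
  have := hN.conj_mem _ (N.inv_mem (hz p)) z⁻¹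
  rw [commutatorElement_inv, commutatorElement_def] at this
  simpa [mul_assoc] using this

/-- If all elements of a coset that is central modulo a normal subgroup act on the kernel of `π`
without fixed points and with full commutator, then the kernel has a contranormal complement. -/
theorem exists_contranormal_complement [hP : Group.IsNilpotent P] (π : G →* P)
    (hπ : Function.Surjective π) (hker : π.ker ≠ ⊥) (N : Subgroup P) [hN : N.Normal] (z : P)
    (hz : ∀ p, ⁅z, p⁆ ∈ N)
    (hfix : ∀ y, z⁻¹ * π y ∈ N → ∀ a, π a = 1 → a * y = y * a → a = 1)
    (hcomm : ∀ y, z⁻¹ * π y ∈ N → ∀ a, π a = 1 → ∃ b, π b = 1 ∧ a = b * y * b⁻¹ * y⁻¹) :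
    ∃ V : Subgroup G, V ≠ ⊤ ∧ Subgroup.normalClosure (V : Set G) = ⊤ := by
  obtain ⟨g, rfl⟩ := hπ z
  have hgN : (π g)⁻¹ * π g ∈ N := by rw [inv_mul_cancel]; exact N.one_mem
  obtain ⟨V, hgV, hVmax⟩ := zorn_le_nonempty₀ {V : Subgroup G | ∀ v ∈ V, π v = 1 → v = 1}
    (fun c hc hch C hC => by
      refine ⟨sSup c, fun v hv => ?_, fun B hB => le_sSup hB⟩
      obtain ⟨B, hB, hvB⟩ := (Subgroup.mem_sSup_of_directedOn ⟨C, hC⟩ hch.directedOn).1 hv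
      exact hc hB v hvB)
    (Subgroup.zpowers g) (by
      rintro v ⟨k, rfl⟩ hv
      exact hfix g hgN _ hv ((Commute.refl g).zpow_left k).eq)
  rw [Subgroup.zpowers_le] at hgV
  have hV := hVmax.prop
  have hnorm : Subgroup.normalizer (V : Set G) ≤ V := by
    refine hVmax.le_of_ge (fun a ha ha1 => ?_) Subgroup.le_normalizer
    refine hfix g hgN a ha1 ?_
    have h1 := V.mul_mem ((Subgroup.mem_normalizer_iff.1 ha g).1 hgV) (V.inv_mem hgV)
    have h2 := hV _ h1 (by simp [ha1])
    rw [mul_inv_eq_one, mul_inv_eq_iff_eq_mul] at h2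
    exact h2
  have htop : V.map π = ⊤ := by
    by_contra hne
    obtain ⟨p, hp, hpV⟩ := SetLike.exists_of_lt
      (Group.normalizerCondition_of_isNilpotent (V.map π) (lt_top_iff_ne_top.2 hne))
    obtain ⟨x, rfl⟩ := hπ p
    obtain ⟨v, hv, hvx⟩ := (Subgroup.mem_normalizer_iff.1 hp (π g)).1 ⟨g, hgV, rfl⟩
    have hvN : (π g)⁻¹ * π v ∈ N := by rw [hvx]; exact map_conj_mem_of_commutator_mem hz _
    obtain ⟨b, hb, hbv⟩ := hcomm v hvN (x * g * x⁻¹ * v⁻¹) (by simp [hvx])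
    have hu : b⁻¹ * x * g * (b⁻¹ * x)⁻¹ = v := by
      rw [mul_left_inj] at hbv
      calc _ = b⁻¹ * (x * g * x⁻¹) * b := by group
        _ = v := by rw [hbv]; group
    set u := b⁻¹ * x with hudef
    have hπu : π u = π x := by simp [hudef, hb]
    obtain ⟨c, hc⟩ := hP.nilpotent
    have hconj : ∀ w ∈ V, ∀ w' ∈ V, π w = π (u * w' * u⁻¹) → w = u * w' * u⁻¹ := by
      intro w hw w' hw' hww'
      refine eq_of_map_eq_of_mem_upperCentralSeries π (W := V.map (MulAut.conj u).toMonoidHom) hv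
        ⟨g, hgV, hu⟩ hV ?_ (hfix v hvN) c w hw _ ⟨w', hw', rfl⟩ hww' (hc ▸ Subgroup.mem_top _)
      rintro _ ⟨t, ht, rfl⟩ h1
      have h2 : π (u * t * u⁻¹) = 1 := h1
      rw [map_mul, map_mul, map_inv, conj_eq_one_iff] at h2
      rw [hV t ht h2, map_one]
    have huV : u ∈ V := by
      refine hnorm (Subgroup.mem_normalizer_iff.2 fun w => ⟨fun hw => ?_, fun hw => ?_⟩)
      · obtain ⟨t, ht, htw⟩ := (Subgroup.mem_normalizer_iff.1 hp (π w)).1 ⟨w, hw, rfl⟩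
        rw [← hconj t ht w hw (by simp [htw, hπu])]
        exact ht
      · obtain ⟨t, ht, htw⟩ := (Subgroup.mem_normalizer_iff.1 hp (π w)).2
          ⟨_, hw, by simp [hπu]⟩
        have := hconj _ hw t ht (by simp [htw])
        rw [mul_left_inj, mul_right_inj] at this
        exact this ▸ ht
    exact hpV (hπu ▸ ⟨u, huV, rfl⟩)
  refine ⟨V, fun h => hker (eq_bot_iff.2 fun a ha => ?_), eq_top_iff.2 fun x _ => ?_⟩
  · exact hV a (h ▸ Subgroup.mem_top a) ha
  · obtain ⟨v, hv, hvx⟩ : π x ∈ V.map π := htop ▸ Subgroup.mem_top _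
    have hsub : ∀ w ∈ V, w ∈ Subgroup.normalClosure (V : Set G) :=
      fun w hw => Subgroup.subset_normalClosure hw
    obtain ⟨b, -, hb⟩ := hcomm g hgN (x * v⁻¹) (by simp [hvx])
    rw [mul_inv_eq_iff_eq_mul] at hb
    rw [hb]
    exact Subgroup.mul_mem _ (Subgroup.mul_mem _
      (Subgroup.normalClosure_normal.conj_mem _ (hsub g hgV) b)
      (Subgroup.inv_mem _ (hsub g hgV))) (hsub v hv)

end Contranormal

section LocallyNilpotent

variable {G P : Type*} [Group G] [Group P]

/-- The iterated commutators of `n + 1` elements of `X`. -/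
def iteratedCommutators (X : Set G) : ℕ → Set G
  | 0 => X
  | n + 1 => Set.image2 (fun a x => ⁅a, x⁆) (iteratedCommutators X n) X

theorem finite_iteratedCommutators {X : Set G} (hX : X.Finite) (n : ℕ) :
    (iteratedCommutators X n).Finite := by
  induction n with
  | zero => exact hX
  | succ n ih => exact ih.image2 _ hX

theorem map_iteratedCommutators_mem (π : G →* P) (X : Set G) (n : ℕ) :
    ∀ a ∈ iteratedCommutators X n, π a ∈ Subgroup.lowerCentralSeries (⊤ : Subgroup P) n := by
  induction n with
  | zero => exact fun a _ => Subgroup.mem_top _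
  | succ n ih =>
    rintro _ ⟨a, ha, x, -, rfl⟩
    rw [map_commutatorElement]
    exact Subgroup.commutator_mem_commutator (ih a ha) (Subgroup.mem_top _)

theorem iteratedCommutators_subset_upperCentralSeries {X : Set G}
    (hX : Subgroup.closure X = ⊤) (n k : ℕ) :
    iteratedCommutators X n ⊆ Subgroup.upperCentralSeries G k →
      X ⊆ Subgroup.upperCentralSeries G (k + n) := by
  induction n generalizing k with
  | zero => exact id
  | succ n ih =>
    intro h
    rw [add_comm n, ← add_assoc]
    refine ih (k + 1) fun a ha => Subgroup.mem_upperCentralSeries_succ_iff.2 fun y => ?_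
    rw [← mem_centralizerMod]
    have : Subgroup.closure X ≤ centralizerMod (Subgroup.upperCentralSeries G k) a :=
      (Subgroup.closure_le _).2 fun x hx => mem_centralizerMod.2 (h ⟨a, ha, x, hx, rfl⟩)
    exact this (hX ▸ Subgroup.mem_top y)

theorem isNilpotent_of_ker_hypercentral [hG : Group.FG G] [hP : Group.IsNilpotent P] (π : G →* P)
    (h : ∀ a, π a = 1 → ∃ n, a ∈ Subgroup.upperCentralSeries G n) : Group.IsNilpotent G := by
  obtain ⟨X, hX⟩ := hG.out
  obtain ⟨c, hc⟩ := Subgroup.nilpotent_iff_lowerCentralSeries.1 hP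
  have hfin := finite_iteratedCommutators X.finite_toSet c
  obtain ⟨n, hn⟩ : ∃ n, iteratedCommutators (X : Set G) c ⊆ Subgroup.upperCentralSeries G n := by
    have hdir : Monotone fun n => (Subgroup.upperCentralSeries G n : Set G) :=
      Subgroup.upperCentralSeries_mono G
    obtain ⟨T, hT⟩ := hfin.exists_finset_coe
    rw [← hT]
    refine hdir.directed_le.exists_mem_subset_of_finset_subset_biUnion fun a ha => ?_
    rw [hT] at ha
    have := map_iteratedCommutators_mem π X c a ha
    rw [hc, Subgroup.mem_bot] at this
    exact Set.mem_iUnion.2 (h a this)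
  exact ⟨n + c, eq_top_iff.2 (hX ▸ (Subgroup.closure_le _).2
    (iteratedCommutators_subset_upperCentralSeries hX c n hn))⟩

theorem mem_upperCentralSeries_of_coe_mem {S : Subgroup G} (n : ℕ) :
    ∀ s : S, (s : G) ∈ Subgroup.upperCentralSeries G n → s ∈ Subgroup.upperCentralSeries S n := by
  induction n with
  | zero =>
    intro s hs
    rw [Subgroup.upperCentralSeries_zero, Subgroup.mem_bot] at hs ⊢
    exact Subtype.ext hs
  | succ n ih =>
    intro s hs
    exact Subgroup.mem_upperCentralSeries_succ_iff.2 fun t =>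
      ih _ (Subgroup.mem_upperCentralSeries_succ_iff.1 hs t)

theorem isNilpotent_of_fg_of_ker_hypercentral [hP : Group.IsNilpotent P] (π : G →* P)
    (h : ∀ a, π a = 1 → ∃ n, a ∈ Subgroup.upperCentralSeries G n) {S : Subgroup G} (hS : S.FG) :
    Group.IsNilpotent S := by
  have : Group.FG S := Group.fg_iff_subgroup_fg S |>.2 hS
  exact isNilpotent_of_ker_hypercentral (π.comp S.subtype) fun a ha =>
    (h a ha).imp fun n hn => mem_upperCentralSeries_of_coe_mem n a hn

end LocallyNilpotent

section Main

open MonoidAlgebra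

theorem exists_proper_contranormal_of_module {G Q V : Type*} [Group G] [Group Q] [AddCommGroup V]
    [Module (MonoidAlgebra ℤ Q) V] (hfg : Group.FG Q) (hnil : Group.IsNilpotent Q) (π : G →* Q)
    (hπ : Function.Surjective π) (ι : V → G) (hadd : ∀ v w, ι (v + w) = ι v * ι w)
    (hinj : Function.Injective ι) (hker : ∀ a, π a = 1 ↔ ∃ v, ι v = a)
    (hconj : ∀ g v, ι (of ℤ Q (π g) • v) = g * ι v * g⁻¹)
    (hnln : ¬ ∀ S : Subgroup G, S.FG → Group.IsNilpotent S) :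
    ∃ H : Subgroup G, H ≠ ⊤ ∧ Subgroup.normalClosure (H : Set G) = ⊤ := by
  have hzero : ι 0 = 1 := by simpa using hadd 0 0
  have hneg : ∀ v, ι (-v) = (ι v)⁻¹ := fun v =>
    eq_inv_of_mul_eq_one_left (by rw [← hadd, neg_add_cancel, hzero])
  have hV : ¬ LocallyUnipotent V (⊤ : Subgroup Q) := by
    intro hV
    have hmem : ∀ n, ∀ v ∈ fixedFiltration V (⊤ : Subgroup Q) n,
        ι v ∈ Subgroup.upperCentralSeries G n := by
      intro n
      induction n with
      | zero =>
        intro v hv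
        rw [(Submodule.mem_bot _).1 hv, hzero]
        exact Subgroup.one_mem _
      | succ n ih =>
        refine fun v hv => Subgroup.mem_upperCentralSeries_succ_iff.2 fun g => ?_
        have h1 := ih _ (Submodule.neg_mem _ (mem_fixedMod.1 hv (π g) (Subgroup.mem_top _)))
        rw [neg_sub, sub_eq_add_neg, hadd, hneg, hconj] at h1
        simpa [commutatorElement_def, mul_assoc] using h1
    refine hnln fun S hS => isNilpotent_of_fg_of_ker_hypercentral π (fun a ha => ?_) hS
    obtain ⟨v, rfl⟩ := (hker a).1 ha
    exact (hV v).imp fun n hn => hmem n v hn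
  obtain ⟨B, N, z, hB, hN, hz, hy⟩ :=
    (CentralChain.top hfg hnil).exists_quotient_sub_bijective hV
  let K : Subgroup G :=
    { carrier := Set.image ι B
      one_mem' := ⟨0, B.zero_mem, hzero⟩
      mul_mem' := by
        rintro _ _ ⟨v, hv, rfl⟩ ⟨w, hw, rfl⟩
        exact ⟨v + w, B.add_mem hv hw, hadd v w⟩
      inv_mem' := by
        rintro _ ⟨v, hv, rfl⟩
        exact ⟨-v, B.neg_mem hv, hneg v⟩ }
  have hK : ∀ v, ι v ∈ K ↔ v ∈ B := fun v => hinj.mem_set_image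
  have hKn : K.Normal := ⟨by
    rintro _ ⟨v, hv, rfl⟩ g
    exact ⟨_, B.smul_mem _ hv, hconj g v⟩⟩
  let πK : G ⧸ K →* Q := QuotientGroup.lift K π (by
    rintro _ ⟨v, -, rfl⟩
    exact (hker _).2 ⟨v, rfl⟩)
  have hπK : ∀ g : G, πK (QuotientGroup.mk g) = π g := fun g => rfl
  obtain ⟨W, hWtop, hW⟩ := exists_contranormal_complement πK
    (fun q => (hπ q).imp' QuotientGroup.mk fun g hg => hg)
    (fun hbot => hB (eq_top_iff.2 fun v _ => by
      have h1 : (QuotientGroup.mk (ι v) : G ⧸ K) ∈ πK.ker := (hker _).2 ⟨v, rfl⟩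
      rw [hbot, Subgroup.mem_bot, QuotientGroup.eq_one_iff, hK] at h1
      exact h1)) N z hz
    (by
      intro y hyN a ha hay
      obtain ⟨g, rfl⟩ := QuotientGroup.mk_surjective y
      obtain ⟨a, rfl⟩ := QuotientGroup.mk_surjective a
      obtain ⟨v, rfl⟩ := (hker a).1 ha
      rw [QuotientGroup.eq_one_iff, hK]
      refine (hy _ hyN).1 v ?_
      rw [← QuotientGroup.mk_mul, ← QuotientGroup.mk_mul, QuotientGroup.eq] at hay
      have h1 := hKn.conj_mem _ hay g
      rw [hπK, ← hK, sub_eq_neg_add, hadd, hneg, hconj]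
      simpa [mul_assoc] using h1)
    (by
      intro y hyN a ha
      obtain ⟨g, rfl⟩ := QuotientGroup.mk_surjective y
      obtain ⟨a, rfl⟩ := QuotientGroup.mk_surjective a
      obtain ⟨v, rfl⟩ := (hker a).1 ha
      obtain ⟨w, hw⟩ := (hy _ hyN).2 v
      refine ⟨QuotientGroup.mk (ι (-w)), (hker _).2 ⟨-w, rfl⟩, ?_⟩
      simp only [← QuotientGroup.mk_mul, ← QuotientGroup.mk_inv]
      rw [QuotientGroup.eq]
      have h1 := (hK _).2 (B.neg_mem hw)
      rw [hπK, neg_sub, sub_eq_neg_add, sub_eq_neg_add, hadd, hadd, hneg, hneg, hconj] at h1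
      rw [hneg]
      simpa [mul_assoc] using h1)
  have hle : Subgroup.normalClosure (W : Set (G ⧸ K)) ≤
      (Subgroup.normalClosure (W.comap (QuotientGroup.mk' K) : Set G)).map
        (QuotientGroup.mk' K) := by
    have := Subgroup.Normal.map (Subgroup.normalClosure_normal
      (s := (W.comap (QuotientGroup.mk' K) : Set G))) _ (QuotientGroup.mk'_surjective K)
    refine Subgroup.normalClosure_le_normal fun w hw => ?_
    obtain ⟨g, rfl⟩ := QuotientGroup.mk'_surjective K w
    exact ⟨g, Subgroup.subset_normalClosure hw, rfl⟩
  refine ⟨W.comap (QuotientGroup.mk' K), fun h => hWtop (eq_top_iff.2 fun w _ => ?_),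
    eq_top_iff.2 fun g _ => ?_⟩
  · obtain ⟨g, rfl⟩ := QuotientGroup.mk'_surjective K w
    exact (h ▸ Subgroup.mem_top g : g ∈ W.comap (QuotientGroup.mk' K))
  · obtain ⟨l, hl, hlg⟩ := hle (hW ▸ Subgroup.mem_top (QuotientGroup.mk' K g))
    have hlK : l⁻¹ * g ∈ K := QuotientGroup.eq.1 hlg
    have hlW : l⁻¹ * g ∈ W.comap (QuotientGroup.mk' K) := by
      rw [Subgroup.mem_comap, QuotientGroup.mk'_apply, (QuotientGroup.eq_one_iff _).2 hlK]
      exact W.one_mem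
    have := Subgroup.mul_mem _ hl (Subgroup.subset_normalClosure hlW)
    rwa [mul_inv_cancel_left] at this

end Main

/-- Let `A` be an abelian normal subgroup of `G` with `G/A` finitely generated nilpotent.
If `G` is not locally nilpotent, then `G` has a proper contranormal subgroup. -/
theorem exists_proper_contranormal {G : Type*} [Group G] (A : Subgroup G)
    [A.Normal] (hab : ∀ x ∈ A, ∀ y ∈ A, x * y = y * x)
    (hfg : Group.FG (G ⧸ A)) (hnil : Group.IsNilpotent (G ⧸ A))
    (hnln : ¬ (∀ S : Subgroup G, S.FG → Group.IsNilpotent S)) :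
    ∃ H : Subgroup G, H ≠ ⊤ ∧ Subgroup.normalClosure (H : Set G) = ⊤ := by
  let _ : CommGroup A :=
    { (inferInstance : Group A) with mul_comm := fun a b => Subtype.ext (hab a a.2 b b.2) }
  let conj : G ⧸ A →* MulAut A := QuotientGroup.lift A MulAut.conjNormal fun a ha => by
    ext b
    rw [MulAut.conjNormal_apply, hab a ha b b.2, mul_inv_cancel_right]
    rfl
  let endo : G ⧸ A →* Module.End ℤ (Additive A) :=
    { toFun := fun q => (MonoidHom.toAdditive (conj q).toMonoidHom).toIntLinearMap
      map_one' := by ext a; simp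
      map_mul' := fun p q => by ext a; simp }
  let _ : Module (MonoidAlgebra ℤ (G ⧸ A)) (Additive A) :=
    Module.compHom _ (MonoidAlgebra.lift ℤ (Module.End ℤ (Additive A)) (G ⧸ A) endo).toRingHom
  refine exists_proper_contranormal_of_module (V := Additive A) hfg hnil (QuotientGroup.mk' A)
    (QuotientGroup.mk'_surjective A) (fun a => (a.toMul : G)) (fun _ _ => rfl)
    (fun a b h => Subtype.ext h) (fun a => ?_) (fun g a => ?_) hnln
  · rw [QuotientGroup.mk'_apply, QuotientGroup.eq_one_iff]
    exact ⟨fun ha => ⟨Additive.ofMul ⟨a, ha⟩, rfl⟩, by rintro ⟨v, rfl⟩; exact v.toMul.2⟩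
  · have h1 : MonoidAlgebra.of ℤ (G ⧸ A) (QuotientGroup.mk' A g) • a =
        endo (QuotientGroup.mk' A g) a :=
      congrArg (· a) (MonoidAlgebra.lift_of endo (QuotientGroup.mk' A g))
    rw [h1]
    rfl
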